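/- Let X be a CAT(0) space and γ a hyperbolic isometry of X. Then Min(γ) is isometric to a product Y × ℝ, where Y = Y × {0} is a closed convex subspace of X; moreover, if X has finite topological dimension, then dim(Y) < dim(X). -/

import Mathlib

open Set

/-- A geodesic from `x` to `y`, affinely parametrized on `[0,1]`. -/
def IsGeodSeg {X : Type*} [MetricSpace X] (x y : X) (γ : ℝ → X) : Prop :=
  γ 0 = x ∧ γ 1 = y ∧
    ∀ s ∈ Icc (0:ℝ) 1, ∀ t ∈ Icc (0:ℝ) 1, dist (γ s) (γ t) = |s - t| * dist x y

/-- A CAT(0) space: a geodesic metric space all of whose geodesic triangles are no fatter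
than Euclidean comparison triangles, expressed via the standard comparison inequality
`d(p, γ(t))² ≤ (1-t)·d(p,x)² + t·d(p,y)² - t(1-t)·d(x,y)²` for geodesics `γ` from `x` to `y`. -/
def IsCAT0 (X : Type*) [MetricSpace X] : Prop :=
  (∀ x y : X, ∃ γ : ℝ → X, IsGeodSeg x y γ) ∧
    ∀ (p x y : X) (γ : ℝ → X), IsGeodSeg x y γ → ∀ t ∈ Icc (0:ℝ) 1,
      dist p (γ t) ^ 2 ≤
        (1 - t) * dist p x ^ 2 + t * dist p y ^ 2 - t * (1 - t) * dist x y ^ 2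

/-- The covering dimension of `X` is at most `n`: every open cover admits an open
refinement covering `X` in which every point lies in at most `n + 1` members. -/
def DimLE (X : Type*) [TopologicalSpace X] (n : ℕ) : Prop :=
  ∀ 𝒰 : Set (Set X), (∀ U ∈ 𝒰, IsOpen U) → ⋃₀ 𝒰 = univ →
    ∃ 𝒱 : Set (Set X), (∀ V ∈ 𝒱, IsOpen V) ∧ ⋃₀ 𝒱 = univ ∧
      (∀ V ∈ 𝒱, ∃ U ∈ 𝒰, V ⊆ U) ∧
      ∀ x : X, {V | V ∈ 𝒱 ∧ x ∈ V}.encard ≤ (n : ℕ∞) + 1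

/-- The topological (covering) dimension of `X`, as an extended natural number. -/
noncomputable def covDim (X : Type*) [TopologicalSpace X] : ℕ∞ :=
  sInf {d : ℕ∞ | ∃ n : ℕ, d = (n : ℕ∞) ∧ DimLE X n}

/-- `Min(γ)`: the set of points where the isometry `γ` attains its translation length
`|γ| = inf_x d(x, γ x)`. -/
def minSet {X : Type*} [MetricSpace X] (γ : X ≃ᵢ X) : Set X :=
  {x : X | ∀ y : X, dist x (γ x) ≤ dist y (γ y)}

/-- An isometry is hyperbolic if it is semi-simple (attains its translation length) and its
translation length is positive. -/
def IsHyperbolic {X : Type*} [MetricSpace X] (γ : X ≃ᵢ X) : Prop :=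
  ∃ x : X, (∀ y : X, dist x (γ x) ≤ dist y (γ y)) ∧ 0 < dist x (γ x)

/-- A subset of a metric space is (geodesically) convex if it contains every geodesic
segment between any two of its points. -/
def GeodConvex {X : Type*} [MetricSpace X] (Y : Set X) : Prop :=
  ∀ x ∈ Y, ∀ y ∈ Y, ∀ γ : ℝ → X, IsGeodSeg x y γ → ∀ t ∈ Set.Icc (0:ℝ) 1, γ t ∈ Y


section Geometry

/-- `m` divides the pair `x, y` in ratio `t`. -/
def BtwPt {X : Type*} [MetricSpace X] (t : ℝ) (x m y : X) : Prop :=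
  dist x m = t * dist x y ∧ dist m y = (1 - t) * dist x y

variable {X : Type*} [MetricSpace X]

lemma isometry_iter {f : X → X} (hf : Isometry f) (n : ℕ) : Isometry f^[n] := by
  induction n with
  | zero => exact isometry_id
  | succ n ih => exact ih.comp hf

lemma geodSeg_btw {x y : X} {σ : ℝ → X} (h : IsGeodSeg x y σ) {t : ℝ} (ht : t ∈ Icc (0:ℝ) 1) :
    BtwPt t x (σ t) y := by
  obtain ⟨h0, h1, h2⟩ := h
  constructor
  · have := h2 0 (by simp) t ht
    rw [h0] at this
    rw [this, zero_sub, abs_neg, abs_of_nonneg ht.1]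
  · have := h2 t ht 1 (by simp)
    rw [h1] at this
    rw [this, abs_sub_comm, abs_of_nonneg (by linarith [ht.2])]

lemma geo_unique (hX : IsCAT0 X) {x y p : X} {σ : ℝ → X} (h : IsGeodSeg x y σ) {t : ℝ}
    (ht : t ∈ Icc (0:ℝ) 1) (hp : BtwPt t x p y) : p = σ t := by
  have h1 := hX.2 p x y σ h t ht
  rw [dist_comm p x, hp.1, hp.2] at h1
  have h2 : dist p (σ t) ^ 2 ≤ 0 := by nlinarith
  have h3 : dist p (σ t) = 0 := by
    have := sq_nonneg (dist p (σ t))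
    exact pow_eq_zero_iff (two_ne_zero) |>.1 (le_antisymm h2 this)
  exact dist_eq_zero.1 h3

lemma cat0_pt (hX : IsCAT0 X) (p : X) {x y m : X} {t : ℝ}
    (ht : t ∈ Icc (0:ℝ) 1) (hm : BtwPt t x m y) :
    dist p m ^ 2 ≤ (1 - t) * dist p x ^ 2 + t * dist p y ^ 2 - t * (1 - t) * dist x y ^ 2 := by
  obtain ⟨σ, hσ⟩ := hX.1 x y
  rw [geo_unique hX hσ ht hm]
  exact hX.2 p x y σ hσ t ht

lemma btwPt_unique (hX : IsCAT0 X) {x y p q : X} {t : ℝ}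
    (ht : t ∈ Icc (0:ℝ) 1) (hp : BtwPt t x p y) (hq : BtwPt t x q y) : p = q := by
  obtain ⟨σ, hσ⟩ := hX.1 x y
  rw [geo_unique hX hσ ht hp, geo_unique hX hσ ht hq]

lemma exists_btw (hX : IsCAT0 X) (x y : X) {t : ℝ} (ht : t ∈ Icc (0:ℝ) 1) : ∃ m, BtwPt t x m y := by
  obtain ⟨σ, hσ⟩ := hX.1 x y
  exact ⟨_, geodSeg_btw hσ ht⟩

lemma thales (hX : IsCAT0 X) {p q q' m m' : X} {t : ℝ} (ht : t ∈ Icc (0:ℝ) 1)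
    (h : BtwPt t p m q) (h' : BtwPt t p m' q') : dist m m' ≤ t * dist q q' := by
  have h1 := cat0_pt hX m' ht h
  have h2 := cat0_pt hX q ht h'
  rw [dist_comm m' p, h'.1, dist_comm m' q] at h1
  rw [dist_comm q p] at h2
  have h3 : dist m m' ^ 2 ≤ (t * dist q q') ^ 2 := by
    rw [dist_comm m m']
    have := mul_le_mul_of_nonneg_left h2 ht.1
    nlinarith
  exact le_of_sq_le_sq h3 (mul_nonneg ht.1 dist_nonneg)
where
  le_of_sq_le_sq {a b : ℝ} (h : a ^ 2 ≤ b ^ 2) (hb : 0 ≤ b) : a ≤ b := by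
    nlinarith [abs_le_of_sq_le_sq h hb]

lemma btwPt_symm {x m y : X} {t : ℝ} (h : BtwPt t x m y) : BtwPt (1 - t) y m x := by
  refine ⟨?_, ?_⟩
  · rw [dist_comm y m, dist_comm y x, h.2]
  · rw [dist_comm m x, dist_comm y x, h.1]; ring

lemma dist_convex (hX : IsCAT0 X) {x y x' y' m m' : X} {t : ℝ} (ht : t ∈ Icc (0:ℝ) 1)
    (h : BtwPt t x m y) (h' : BtwPt t x' m' y') :
    dist m m' ≤ (1 - t) * dist x x' + t * dist y y' := by
  obtain ⟨n, hn⟩ := exists_btw hX x y' ht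
  have h1 := thales hX ht h hn
  have h2 := thales hX (t := 1 - t) ⟨by linarith [ht.2], by linarith [ht.1]⟩
    (btwPt_symm hn) (btwPt_symm h')
  linarith [dist_triangle m n m']

lemma quad_ineq (hX : IsCAT0 X) (p q r u : X) :
    dist p r ^ 2 + dist q u ^ 2 ≤ dist p q ^ 2 + dist q r ^ 2 + dist r u ^ 2 + dist u p ^ 2 := by
  have ht : (1/2 : ℝ) ∈ Icc (0:ℝ) 1 := by constructor <;> norm_num
  obtain ⟨m, hm⟩ := exists_btw hX p r ht
  have h1 := cat0_pt hX q ht hm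
  have h2 := cat0_pt hX u ht hm
  have h3 := dist_triangle_right q u m
  have h4 : dist q u ^ 2 ≤ (dist q m + dist u m) ^ 2 := by
    have := dist_nonneg (x := q) (y := u)
    gcongr
  rw [dist_comm q p] at h1
  rw [dist_comm u r] at h2
  nlinarith [sq_nonneg (dist q m - dist u m)]

lemma disp_double (hX : IsCAT0 X) {f : X → X} (hf : Isometry f) {a : ℝ}
    (ha : ∀ y, a ≤ dist y (f y)) (y : X) : 2 * a ≤ dist y (f (f y)) := by
  have ht : (1/2 : ℝ) ∈ Icc (0:ℝ) 1 := by constructor <;> norm_num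
  obtain ⟨m, hm⟩ := exists_btw hX (f y) y ht
  have hm2 : BtwPt (1/2) (f (f y)) (f m) (f y) := ⟨by rw [hf.dist_eq, hf.dist_eq]; exact hm.1,
    by rw [hf.dist_eq, hf.dist_eq]; exact hm.2⟩
  have hm3 := btwPt_symm hm2
  norm_num at hm3
  have h1 := thales hX ht hm (by norm_num; exact hm3)
  have := ha m
  linarith

lemma disp_pow (hX : IsCAT0 X) (k : ℕ) : ∀ {f : X → X} (_ : Isometry f) {a : ℝ}
    (_ : ∀ y, a ≤ dist y (f y)) (y : X), 2 ^ k * a ≤ dist y (f^[2 ^ k] y) := by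
  induction k with
  | zero => intro f hf a ha y; simpa using ha y
  | succ k ih =>
    intro f hf a ha y
    have := ih (f := f^[2]) (isometry_iter hf 2) (a := 2 * a) (fun y => by
      simpa using disp_double hX hf ha y) y
    rw [← Function.iterate_mul] at this
    rw [pow_succ', pow_succ']
    linarith

lemma disp_le {f : X → X} (hf : Isometry f) (x : X) (j : ℕ) :
    dist x (f^[j] x) ≤ j * dist x (f x) := by
  induction j with
  | zero => simp
  | succ j ih =>
    have h1 := dist_triangle x (f^[j] x) (f^[j+1] x)
    have h2 : dist (f^[j] x) (f^[j+1] x) = dist x (f x) := by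
      rw [Function.iterate_succ_apply, (isometry_iter hf j).dist_eq]
    push_cast
    linarith

lemma disp_eq (hX : IsCAT0 X) {f : X → X} (hf : Isometry f) {x : X}
    (hx : ∀ y, dist x (f x) ≤ dist y (f y)) (j : ℕ) :
    dist x (f^[j] x) = j * dist x (f x) := by
  refine le_antisymm (disp_le hf x j) ?_
  have hj : j ≤ 2 ^ j := Nat.lt_two_pow_self.le
  have h1 := disp_pow hX j hf hx x
  have h2 := dist_triangle x (f^[j] x) (f^[2^j] x)
  have h3 : dist (f^[j] x) (f^[2^j] x) = dist x (f^[2^j - j] x) := by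
    conv_lhs => rw [show 2 ^ j = j + (2^j - j) by omega]
    rw [Function.iterate_add_apply, (isometry_iter hf j).dist_eq]
  have h4 := disp_le hf x (2^j - j)
  rw [Nat.cast_sub hj] at h4
  push_cast at h4
  nlinarith

end Geometry

section Axes

/-- An axis of the isometry `γ` with translation length `a`. -/
def IsAxis {X : Type*} [MetricSpace X] (γ : X ≃ᵢ X) (a : ℝ) (c : ℝ → X) : Prop :=
  (∀ s t, dist (c s) (c t) = |s - t|) ∧ ∀ t, γ (c t) = c (t + a)

variable {X : Type*} [MetricSpace X]

lemma zpow_dist (hX : IsCAT0 X) (γ : X ≃ᵢ X) {x : X}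
    (hx : ∀ y, dist x (γ x) ≤ dist y (γ y)) (k l : ℤ) :
    dist ((γ ^ k) x) ((γ ^ l) x) = |(l : ℝ) - k| * dist x (γ x) := by
  have key : ∀ (k : ℤ) (n : ℕ), dist ((γ ^ k) x) ((γ ^ (k + n)) x) = n * dist x (γ x) := by
    intro k n
    rw [zpow_add, IsometryEquiv.mul_apply, IsometryEquiv.dist_eq]
    have h1 : (γ ^ (n : ℤ)) x = γ^[n] x := by
      rw [zpow_natCast]
      induction n with
      | zero => rfl
      | succ n ih => rw [pow_succ', IsometryEquiv.mul_apply, ih, Function.iterate_succ_apply']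
    rw [h1]
    exact disp_eq hX γ.isometry hx n
  rcases le_total k l with h | h
  · obtain ⟨n, rfl⟩ := Int.le.dest h
    rw [key]; push_cast; rw [add_sub_cancel_left, abs_of_nonneg (by positivity)]
  · obtain ⟨n, rfl⟩ := Int.le.dest h
    rw [dist_comm, key]; push_cast; rw [abs_sub_comm, add_sub_cancel_left, abs_of_nonneg (by positivity)]

lemma exists_axis (hX : IsCAT0 X) (γ : X ≃ᵢ X) {x : X}
    (hx : ∀ y, dist x (γ x) ≤ dist y (γ y)) (ha : 0 < dist x (γ x)) :
    ∃ c, IsAxis γ (dist x (γ x)) c ∧ c 0 = x := by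
  set a := dist x (γ x) with hadef
  obtain ⟨g, hg⟩ := hX.1 x (γ x)
  let p : ℝ → X := fun u => (γ ^ ⌊u⌋) (g (Int.fract u))
  have hfr : ∀ u : ℝ, Int.fract u ∈ Icc (0:ℝ) 1 := fun u =>
    ⟨Int.fract_nonneg u, (Int.fract_lt_one u).le⟩
  have hp1 : ∀ u, dist ((γ ^ ⌊u⌋) x) (p u) = Int.fract u * a := fun u => by
    rw [IsometryEquiv.dist_eq]; exact (geodSeg_btw hg (hfr u)).1
  have hp2 : ∀ u, dist (p u) ((γ ^ (⌊u⌋ + 1)) x) = (1 - Int.fract u) * a := fun u => by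
    rw [zpow_add, IsometryEquiv.mul_apply, IsometryEquiv.dist_eq, zpow_one]
    exact (geodSeg_btw hg (hfr u)).2
  have key : ∀ u v, u ≤ v → dist (p u) (p v) = (v - u) * a := by
    intro u v huv
    have hf : ⌊u⌋ ≤ ⌊v⌋ := Int.floor_mono huv
    have e1 := Int.floor_add_fract u
    have e2 := Int.floor_add_fract v
    rcases hf.eq_or_lt with h | h
    · have : dist (p u) (p v) = |Int.fract u - Int.fract v| * a := by
        simp only [p]
        rw [h, IsometryEquiv.dist_eq]
        exact hg.2.2 _ (hfr u) _ (hfr v)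
      rw [this]
      rw [h] at e1
      rw [abs_sub_comm, abs_of_nonneg (by linarith)]
      congr 1; linarith
    · have hk : (⌊u⌋ : ℝ) + 1 ≤ ⌊v⌋ := by exact_mod_cast h
      have d1 := zpow_dist hX γ hx (⌊u⌋ + 1) ⌊v⌋
      have d2 := zpow_dist hX γ hx ⌊u⌋ (⌊v⌋ + 1)
      rw [abs_of_nonneg (by push_cast; linarith)] at d1
      rw [abs_of_nonneg (by push_cast; linarith)] at d2
      rw [← hadef] at d1 d2
      push_cast at d1 d2
      have t1 := dist_triangle4 (p u) ((γ ^ (⌊u⌋ + 1)) x) ((γ ^ ⌊v⌋) x) (p v)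
      have t2 := dist_triangle4 ((γ ^ ⌊u⌋) x) (p u) (p v) ((γ ^ (⌊v⌋ + 1)) x)
      rw [hp2, hp1, d1] at t1
      rw [hp2, hp1, d2] at t2
      have e3 : (v - u) * a = (⌊v⌋ + Int.fract v - (⌊u⌋ + Int.fract u)) * a := by rw [e1, e2]
      rw [e3]
      apply le_antisymm
      · nlinarith
      · nlinarith
  refine ⟨fun t => p (t / a), ⟨?_, ?_⟩, ?_⟩
  · intro s t
    rcases le_total s t with h | h
    · rw [key _ _ (by gcongr), abs_sub_comm, abs_of_nonneg (by linarith)]; field_simp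
    · rw [dist_comm, key _ _ (by gcongr), abs_of_nonneg (by linarith)]; field_simp
  · intro t
    have : (t + a) / a = t / a + 1 := by field_simp
    simp only [p]
    rw [this, Int.floor_add_one, Int.fract_add_one, add_comm, zpow_add, zpow_one,
      IsometryEquiv.mul_apply]
  · simp only [p, zero_div, Int.floor_zero, Int.fract_zero, zpow_zero]
    exact hg.1

lemma line_btw {c : ℝ → X} (hc : ∀ s t, dist (c s) (c t) = |s - t|) (u v : ℝ) {t : ℝ}
    (ht : t ∈ Icc (0:ℝ) 1) : BtwPt t (c u) (c ((1 - t) * u + t * v)) (c v) := by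
  constructor
  · rw [hc, hc, show u - ((1 - t) * u + t * v) = t * (u - v) by ring, abs_mul, abs_of_nonneg ht.1]
  · rw [hc, hc, show ((1 - t) * u + t * v) - v = (1 - t) * (u - v) by ring, abs_mul,
      abs_of_nonneg (by linarith [ht.2])]

lemma axis_par (hX : IsCAT0 X) {γ : X ≃ᵢ X} {a : ℝ} (ha : 0 < a) {c c' : ℝ → X}
    (hc : IsAxis γ a c) (hc' : IsAxis γ a c') (s t u : ℝ) :
    dist (c (s + u)) (c' (t + u)) = dist (c s) (c' t) := by
  set f : ℝ → ℝ := fun u => dist (c (s + u)) (c' (t + u)) with hf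
  have hper : ∀ u, f (u + a) = f u := fun u => by
    simp only [hf]
    rw [← add_assoc, ← add_assoc, ← hc.2, ← hc'.2, IsometryEquiv.dist_eq]
  have hperN : ∀ (n : ℕ) u, f (u + n * a) = f u := by
    intro n
    induction n with
    | zero => intro u; simp
    | succ n ih => intro u; rw [← ih u, ← hper (u + n * a)]; congr 1; push_cast; ring
  have hconv : ∀ u v, ∀ r ∈ Icc (0:ℝ) 1, f ((1 - r) * u + r * v) ≤ (1 - r) * f u + r * f v := by
    intro u v r hr
    have h1 := line_btw hc.1 (s + u) (s + v) hr
    have h2 := line_btw hc'.1 (t + u) (t + v) hr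
    have := dist_convex hX hr h1 h2
    simp only [hf]
    convert this using 3 <;> ring
  have hle : ∀ u v, f v ≤ f u := by
    intro u v
    obtain ⟨n, hn⟩ := exists_nat_gt (|u - v| / a)
    rw [div_lt_iff₀ ha] at hn
    have hpos : 0 < n * a := lt_of_le_of_lt (abs_nonneg _) hn
    have hb := abs_lt.1 hn
    have := hconv (u - n * a) (u + n * a) ((v - u + n * a) / (2 * (n * a))) ⟨by
      apply div_nonneg <;> linarith, by rw [div_le_one (by linarith)]; linarith⟩
    rw [hperN, show f (u - n * a) = f u by rw [← hperN n (u - n * a)]; congr 1; ring] at this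
    convert this using 2
    · generalize (n : ℝ) * a = q at hpos
      field_simp; ring
    · ring
  have := le_antisymm (hle 0 u) (hle u 0)
  simpa [hf] using this

lemma affine_of_convex {K : ℝ → ℝ} (h0 : K 0 = 0) (hodd : ∀ t, K (-t) = - K t)
    (hconv : ∀ u v, ∀ r ∈ Icc (0:ℝ) 1, K ((1 - r) * u + r * v) ≤ (1 - r) * K u + r * K v) (t : ℝ) :
    K t = t * K 1 := by
  have h1 : ∀ s t : ℝ, 0 < t → t ≤ s → K t = (t / s) * K s := by
    intro s t ht hts
    have hr : t / s ∈ Icc (0:ℝ) 1 := ⟨by have := ht.trans_le hts; positivity,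
      by rw [div_le_one (ht.trans_le hts)]; exact hts⟩
    have hs : s ≠ 0 := (ht.trans_le hts).ne'
    have a1 := hconv 0 s _ hr
    have a2 := hconv 0 (-s) _ hr
    rw [h0, hodd] at a2
    rw [h0] at a1
    rw [show (1 - t / s) * 0 + t / s * s = t by field_simp; ring] at a1
    rw [show (1 - t / s) * 0 + t / s * -s = -t by field_simp; ring, hodd] at a2
    linarith
  have h2 : ∀ t : ℝ, 0 < t → K t = t * K 1 := by
    intro t ht
    rcases le_total t 1 with h | h
    · simpa using h1 1 t ht h
    · have := h1 t 1 one_pos h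
      rw [this]; field_simp
  rcases lt_trichotomy t 0 with h | h | h
  · have := h2 (-t) (by linarith)
    rw [hodd] at this; linarith
  · rw [h, h0]; simp
  · exact h2 t h

lemma axis_dist (hX : IsCAT0 X) {γ : X ≃ᵢ X} {a : ℝ} (ha : 0 < a) {c c' : ℝ → X}
    (hc : IsAxis γ a c) (hc' : IsAxis γ a c') :
    ∃ o D : ℝ, 0 ≤ D ∧ ∀ s t, dist (c s) (c' t) ^ 2 = (t - s - o) ^ 2 + D := by
  set h : ℝ → ℝ := fun t => dist (c 0) (c' t) ^ 2 with hh
  have hshift : ∀ s t, dist (c s) (c' t) ^ 2 = h (t - s) := by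
    intro s t
    have := axis_par hX ha hc hc' 0 (t - s) s
    rw [zero_add, sub_add_cancel] at this
    rw [this]
  have hconv : ∀ u v, ∀ r ∈ Icc (0:ℝ) 1,
      h ((1 - r) * u + r * v) ≤ (1 - r) * h u + r * h v - r * (1 - r) * (u - v) ^ 2 := by
    intro u v r hr
    have := cat0_pt hX (c 0) hr (line_btw hc'.1 u v hr)
    rwa [hc'.1 u v, sq_abs] at this
  have hmid : ∀ t s, h (t + s) + h (t - s) ≤ 2 * s ^ 2 + 2 * h t := by
    intro t s
    have := quad_ineq hX (c 0) (c s) (c' (t + s)) (c' t)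
    rw [hshift, hshift, hshift, hc.1, hc'.1, dist_comm (c' t), hshift] at this
    simp only [sub_zero, zero_sub, sq_abs, add_sub_cancel_left, add_sub_cancel_right] at this
    rw [neg_sq] at this
    linarith
  set K : ℝ → ℝ := fun t => h t - t ^ 2 - h 0 with hK
  have hKc : ∀ u v, ∀ r ∈ Icc (0:ℝ) 1, K ((1 - r) * u + r * v) ≤ (1 - r) * K u + r * K v := by
    intro u v r hr
    have := hconv u v r hr
    simp only [hK]
    linarith
  have hK0 : K 0 = 0 := by simp [hK]
  have hodd : ∀ t, K (-t) = - K t := by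
    intro t
    have h1 := hKc (-t) t (1/2) ⟨by norm_num, by norm_num⟩
    rw [show (1 - 1 / 2 : ℝ) * -t + 1 / 2 * t = 0 by ring, hK0] at h1
    have h2 := hmid 0 t
    rw [zero_add, zero_sub] at h2
    have h3 : K t + K (-t) ≤ 0 := by simp only [hK]; linarith
    linarith
  have haff := affine_of_convex hK0 hodd hKc
  have hform : ∀ t, h t = (t - (-(K 1 / 2))) ^ 2 + (h 0 - (K 1 / 2) ^ 2) := by
    intro t
    have h2 := haff t
    have h1 : K t = h t - t ^ 2 - h 0 := rfl
    linear_combination h2 - h1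
  refine ⟨-(K 1 / 2), h 0 - (K 1 / 2) ^ 2, ?_, ?_⟩
  · have h1 := hform (-(K 1 / 2))
    have h2 : 0 ≤ h (-(K 1 / 2)) := sq_nonneg _
    rw [sub_self] at h1
    linarith
  · intro s t
    rw [hshift, hform]

lemma le_of_sq_aux {d u D ε : ℝ} (hd : d ^ 2 = u ^ 2 + D) (hε : 0 < ε) (hu : 0 < u)
    (huD : D ≤ u * ε) : d ≤ u + ε := by
  apply le_of_sq_le_sq' _ (by linarith)
  rw [hd]; nlinarith
where
  le_of_sq_le_sq' {a b : ℝ} (h : a ^ 2 ≤ b ^ 2) (hb : 0 ≤ b) : a ≤ b := (le_abs_self a).trans (abs_le_of_sq_le_sq h hb)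

lemma axis_add_aux {d1 d2 d3 : ℝ → ℝ} {o1 o2 o3 D1 D2 D3 : ℝ} (hD3 : 0 ≤ D3)
    (hd3 : ∀ t, 0 ≤ d3 t)
    (h1 : ∀ t, d1 t ^ 2 = (t - o1) ^ 2 + D1) (h2 : ∀ t, d2 t ^ 2 = (t - o2) ^ 2 + D2)
    (h3 : ∀ t, d3 t ^ 2 = (2 * t - o3) ^ 2 + D3) (ht : ∀ t, d3 t ≤ d1 t + d2 t) :
    o1 + o2 ≤ o3 := by
  by_contra hcon
  push Not at hcon
  set ε := (o1 + o2 - o3) / 4 with hε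
  have hεp : 0 < ε := by rw [hε]; linarith
  let t := |o1| + |o2| + |D1| / ε + |D2| / ε + 1
  have p1 : 0 ≤ |D1| / ε := by positivity
  have p2 : 0 ≤ |D2| / ε := by positivity
  have q1 : |D1| / ε ≤ t - o1 := by
    have := le_abs_self o1; have := abs_nonneg o2; simp only [t]; linarith
  have q2 : |D2| / ε ≤ t - o2 := by
    have := le_abs_self o2; have := abs_nonneg o1; simp only [t]; linarith
  have r1 : 0 < t - o1 := by
    have := le_abs_self o1; have := abs_nonneg o2; simp only [t]; linarith
  have r2 : 0 < t - o2 := by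
    have := le_abs_self o2; have := abs_nonneg o1; simp only [t]; linarith
  rw [div_le_iff₀ hεp] at q1 q2
  have s1 := le_of_sq_aux (h1 t) hεp r1 (by linarith [le_abs_self D1])
  have s2 := le_of_sq_aux (h2 t) hεp r2 (by linarith [le_abs_self D2])
  have s3 : 2 * t - o3 ≤ d3 t := by
    exact (le_abs_self _).trans (abs_le_of_sq_le_sq (by rw [h3]; linarith) (hd3 t))
  have := ht t
  linarith

lemma axis_add {c c' c'' : ℝ → X} {o1 o2 o3 D1 D2 D3 : ℝ} (hD3 : 0 ≤ D3)
    (h1 : ∀ s t, dist (c s) (c' t) ^ 2 = (t - s - o1) ^ 2 + D1)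
    (h2 : ∀ s t, dist (c' s) (c'' t) ^ 2 = (t - s - o2) ^ 2 + D2)
    (h3 : ∀ s t, dist (c s) (c'' t) ^ 2 = (t - s - o3) ^ 2 + D3) : o3 = o1 + o2 := by
  apply le_antisymm
  · have := axis_add_aux (d1 := fun t => dist (c 0) (c' (-t)))
      (d2 := fun t => dist (c' (-t)) (c'' (-(2 * t)))) (d3 := fun t => dist (c 0) (c'' (-(2 * t))))
      (o1 := -o1) (o2 := -o2) (o3 := -o3) (D1 := D1) (D2 := D2) hD3 (fun _ => dist_nonneg)
      (fun t => by rw [h1]; ring) (fun t => by rw [h2]; ring) (fun t => by rw [h3]; ring)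
      (fun t => dist_triangle _ _ _)
    linarith
  · exact axis_add_aux (d1 := fun t => dist (c 0) (c' t))
      (d2 := fun t => dist (c' t) (c'' (2 * t))) (d3 := fun t => dist (c 0) (c'' (2 * t)))
      (D1 := D1) (D2 := D2) hD3 (fun _ => dist_nonneg)
      (fun t => by rw [h1]; ring) (fun t => by rw [h2]; ring) (fun t => by rw [h3]; ring)
      (fun t => dist_triangle _ _ _)

end Axes

section Split

variable {X : Type*} [MetricSpace X]

lemma split_geom (hX : IsCAT0 X) (γ : X ≃ᵢ X) (hγ : IsHyperbolic γ) :
    IsClosed (minSet γ) ∧ ∃ Y : Set X, Y.Nonempty ∧ Y ⊆ minSet γ ∧ IsClosed Y ∧ GeodConvex Y ∧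
      ∃ e : Y × ℝ ≃ minSet γ,
        (∀ y : Y, ((e (y, 0) : X)) = (y : X)) ∧
        (∀ p q : Y × ℝ,
          dist (e p : X) (e q : X) ^ 2
            = dist (p.1 : X) (q.1 : X) ^ 2 + (p.2 - q.2) ^ 2) := by
  obtain ⟨x0, hx0, ha⟩ := hγ
  set a := dist x0 (γ x0) with hadef
  have hmin : ∀ x, x ∈ minSet γ ↔ dist x (γ x) ≤ a := by
    intro x
    exact ⟨fun h => h x0, fun h y => h.trans (hx0 y)⟩
  have hmin' : ∀ x ∈ minSet γ, dist x (γ x) = a := fun x hx =>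
    le_antisymm ((hmin x).1 hx) (hx0 x)
  have hclosed : IsClosed (minSet γ) := by
    have : minSet γ = {x | dist x (γ x) ≤ a} := by ext x; exact hmin x
    rw [this]
    exact isClosed_le (continuous_id.dist γ.continuous) continuous_const
  refine ⟨hclosed, ?_⟩
  have hax : ∀ x : X, ∃ c, x ∈ minSet γ → IsAxis γ a c ∧ c 0 = x := by
    intro x
    by_cases hx : x ∈ minSet γ
    · obtain ⟨c, hc⟩ := exists_axis hX γ hx (by rw [hmin' x hx]; exact ha)
      rw [hmin' x hx] at hc
      exact ⟨c, fun _ => hc⟩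
    · exact ⟨fun _ => x, fun h => absurd h hx⟩
  choose ax hax using hax
  have hx0m : x0 ∈ minSet γ := hx0
  set c0 := ax x0 with hc0
  have hc0a : IsAxis γ a c0 := (hax x0 hx0m).1
  have hc00 : c0 0 = x0 := (hax x0 hx0m).2
  set b : X → ℝ := fun x => (dist (c0 1) x ^ 2 - dist (c0 0) x ^ 2 - 1) / 2 with hb
  have hbc : Continuous b := by
    simp only [hb]; fun_prop
  have hmem : ∀ x ∈ minSet γ, ∀ t, ax x t ∈ minSet γ := by
    intro x hx t
    rw [hmin, (hax x hx).1.2, (hax x hx).1.1]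
    simp [abs_of_pos ha]
  have hb1 : ∀ c : ℝ → X, ∀ o D : ℝ, (∀ s t, dist (c0 s) (c t) ^ 2 = (t - s - o) ^ 2 + D) →
      ∀ t, b (c t) = o - t := by
    intro c o D h t
    simp only [hb]
    rw [h, h]; ring
  -- distance between axes
  have hdist : ∀ x ∈ minSet γ, ∀ y ∈ minSet γ, ∃ D, 0 ≤ D ∧
      ∀ s t, dist (ax x s) (ax y t) ^ 2 = (t - s - (b y - b x)) ^ 2 + D := by
    intro x hx y hy
    obtain ⟨o1, D1, hD1, h1⟩ := axis_dist hX ha hc0a (hax x hx).1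
    obtain ⟨o2, D2, hD2, h2⟩ := axis_dist hX ha (hax x hx).1 (hax y hy).1
    obtain ⟨o3, D3, hD3, h3⟩ := axis_dist hX ha hc0a (hax y hy).1
    have e := axis_add hD3 h1 h2 h3
    have e1 := hb1 _ _ _ h1 0
    have e3 := hb1 _ _ _ h3 0
    rw [(hax x hx).2] at e1
    rw [(hax y hy).2] at e3
    refine ⟨D2, hD2, fun s t => ?_⟩
    rw [h2]
    have : o2 = b y - b x := by linarith
    rw [this]
  have hbt : ∀ x ∈ minSet γ, ∀ t, b (ax x t) = b x - t := by
    intro x hx t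
    obtain ⟨o1, D1, hD1, h1⟩ := axis_dist hX ha hc0a (hax x hx).1
    have e1 := hb1 _ _ _ h1 0
    rw [(hax x hx).2] at e1
    rw [hb1 _ _ _ h1 t]; linarith
  have huniq : ∀ x ∈ minSet γ, ∀ t s, ax (ax x t) s = ax x (t + s) := by
    intro x hx t s
    obtain ⟨D, hD, h⟩ := hdist x hx (ax x t) (hmem x hx t)
    have h0 := h t 0
    rw [(hax _ (hmem x hx t)).2, dist_self, hbt x hx] at h0
    have hD0 : D = 0 := by nlinarith
    have h1 := h (t + s) s
    rw [hbt x hx, hD0] at h1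
    have h2 : dist (ax x (t + s)) (ax (ax x t) s) ^ 2 = 0 := by rw [h1]; ring
    exact (dist_eq_zero.1 (pow_eq_zero_iff two_ne_zero |>.1 h2)).symm
  set Y : Set X := minSet γ ∩ {x | b x = 0} with hY
  have hformula : ∀ p q : Y × ℝ, dist (ax p.1 p.2) (ax q.1 q.2) ^ 2
            = dist (p.1 : X) (q.1 : X) ^ 2 + (p.2 - q.2) ^ 2 := by
    rintro ⟨⟨y, hy⟩, s⟩ ⟨⟨z, hz⟩, t⟩
    obtain ⟨D, hD, h⟩ := hdist y hy.1 z hz.1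
    have h0 := h 0 0
    rw [(hax y hy.1).2, (hax z hz.1).2] at h0
    have e1 : b y = 0 := hy.2
    have e2 : b z = 0 := hz.2
    simp only
    rw [h, h0, e1, e2]; ring
  refine ⟨Y, ⟨x0, hx0m, ?_⟩, inter_subset_left,
    hclosed.inter (isClosed_eq hbc continuous_const), ?_, ?_⟩
  · show b x0 = 0
    simp only [hb]
    rw [← hc00, hc0a.1, hc0a.1]; norm_num
  · intro y hy z hz σ hσ t ht
    have hbw := geodSeg_btw hσ ht
    set m := σ t
    have hm : m ∈ minSet γ := by
      rw [hmin]
      have hbw' : BtwPt t (γ y) (γ m) (γ z) :=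
        ⟨by rw [IsometryEquiv.dist_eq, IsometryEquiv.dist_eq]; exact hbw.1,
         by rw [IsometryEquiv.dist_eq, IsometryEquiv.dist_eq]; exact hbw.2⟩
      have := dist_convex hX ht hbw hbw'
      rw [hmin' y hy.1, hmin' z hz.1] at this
      linarith
    refine ⟨hm, ?_⟩
    show b m = 0
    obtain ⟨D1, hD1, h1⟩ := hdist y hy.1 m hm
    obtain ⟨D2, hD2, h2⟩ := hdist z hz.1 m hm
    have ey : b y = 0 := hy.2
    have ez : b z = 0 := hz.2
    have p1 := h1 0 0
    have p2 := h1 0 (b m)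
    have q1 := h2 0 0
    have q2 := h2 0 (b m)
    rw [(hax y hy.1).2, ey] at p1 p2
    rw [(hax z hz.1).2, ez] at q1 q2
    rw [(hax m hm).2] at p1 q1
    have t1 := dist_triangle_right y z (ax m (b m))
    have t2 : dist y m + dist z m = dist y z := by
      rw [dist_comm z m, hbw.1, hbw.2]; ring
    have u1 : dist y (ax m (b m)) ≤ dist y m := by
      refine (le_abs_self _).trans (abs_le_of_sq_le_sq ?_ dist_nonneg)
      rw [p1, p2]; nlinarith
    have u2 : dist z (ax m (b m)) ≤ dist z m := by
      refine (le_abs_self _).trans (abs_le_of_sq_le_sq ?_ dist_nonneg)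
      rw [q1, q2]; nlinarith
    have u3 : dist y (ax m (b m)) = dist y m := by linarith
    rw [u3, p1] at p2
    have : b m ^ 2 = 0 := by linarith
    exact pow_eq_zero_iff two_ne_zero |>.1 this
  · let f : Y × ℝ → minSet γ := fun p => ⟨ax p.1 p.2, hmem p.1 p.1.2.1 p.2⟩
    have hfb : Function.Bijective f := by
      constructor
      · intro p q hpq
        have h := hformula p q
        have h1 : ax p.1 p.2 = ax q.1 q.2 := congrArg Subtype.val hpq
        rw [h1, dist_self] at h
        have h2 : dist (p.1 : X) q.1 ^ 2 = 0 := by nlinarith [sq_nonneg (dist (p.1 : X) q.1), sq_nonneg (p.2 - q.2)]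
        have h3 : (p.2 - q.2) ^ 2 = 0 := by nlinarith
        have h4 := dist_eq_zero.1 (pow_eq_zero_iff two_ne_zero |>.1 h2)
        have h5 := pow_eq_zero_iff two_ne_zero |>.1 h3
        exact Prod.ext (Subtype.ext h4) (by linarith)
      · rintro ⟨x, hx⟩
        refine ⟨(⟨ax x (b x), hmem x hx _, ?_⟩, -b x), ?_⟩
        · show b _ = 0
          rw [hbt x hx]; ring
        · apply Subtype.ext
          show ax (ax x (b x)) (-b x) = x
          rw [huniq x hx, add_neg_cancel, (hax x hx).2]
    refine ⟨Equiv.ofBijective f hfb, ?_, ?_⟩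
    · intro y
      exact (hax y y.2.1).2
    · intro p q
      exact hformula p q

end Split

section DimBasics

universe u v

lemma dimLE_of_slice {Y : Type u} [TopologicalSpace Y] {n : ℕ} (h : DimLE (Y × ℝ) n) :
    DimLE Y n := by
  intro 𝒰 hU hc
  obtain ⟨𝒱, hV1, hV2, hV3, hV4⟩ := h ((fun U => Prod.fst ⁻¹' U) '' 𝒰)
    (by rintro _ ⟨U, hUm, rfl⟩; exact (hU U hUm).preimage continuous_fst)
    (by
      rw [eq_univ_iff_forall]
      rintro ⟨y, t⟩
      obtain ⟨U, hUm, hy⟩ := mem_sUnion.1 (hc ▸ mem_univ y)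
      exact ⟨_, ⟨U, hUm, rfl⟩, hy⟩)
  refine ⟨(fun V => (fun y => (y, (0:ℝ))) ⁻¹' V) '' 𝒱, ?_, ?_, ?_, ?_⟩
  · rintro _ ⟨V, hVm, rfl⟩
    exact (hV1 V hVm).preimage (by fun_prop)
  · rw [eq_univ_iff_forall]
    intro y
    obtain ⟨V, hVm, hy⟩ := mem_sUnion.1 (hV2 ▸ mem_univ (y, (0:ℝ)))
    exact ⟨_, ⟨V, hVm, rfl⟩, hy⟩
  · rintro _ ⟨V, hVm, rfl⟩
    obtain ⟨_, ⟨U, hUm, rfl⟩, hsub⟩ := hV3 V hVm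
    exact ⟨U, hUm, fun y hy => hsub hy⟩
  · intro y
    refine le_trans ?_ (hV4 (y, 0))
    refine le_trans (encard_le_encard ?_) (encard_image_le (fun V => (fun y => (y, (0:ℝ))) ⁻¹' V) _)
    rintro _ ⟨⟨V, hVm, rfl⟩, hy⟩
    exact ⟨V, ⟨hVm, hy⟩, rfl⟩

lemma dimLE_of_closedEmbedding {A : Type u} {X : Type v} [TopologicalSpace A] [TopologicalSpace X]
    {f : A → X} (hf : Topology.IsClosedEmbedding f) {n : ℕ} (h : DimLE X n) : DimLE A n := by
  intro 𝒰 hU hc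
  obtain ⟨𝒱, hV1, hV2, hV3, hV4⟩ := h ({V | IsOpen V ∧ ∃ U ∈ 𝒰, f ⁻¹' V ⊆ U} ∪ {(range f)ᶜ})
    (by
      rintro V (hV | hV)
      · exact hV.1
      · rw [hV]; exact hf.isClosed_range.isOpen_compl)
    (by
      rw [eq_univ_iff_forall]
      intro x
      by_cases hx : x ∈ range f
      · obtain ⟨a, rfl⟩ := hx
        obtain ⟨U, hUm, ha⟩ := mem_sUnion.1 (hc ▸ mem_univ a)
        obtain ⟨V, hV, hVU⟩ := hf.isOpen_iff.1 (hU U hUm)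
        exact ⟨V, Or.inl ⟨hV, U, hUm, hVU.le⟩, by rw [← hVU] at ha; exact ha⟩
      · exact ⟨_, Or.inr rfl, hx⟩)
  refine ⟨(fun V => f ⁻¹' V) '' {V | V ∈ 𝒱 ∧ (f ⁻¹' V).Nonempty}, ?_, ?_, ?_, ?_⟩
  · rintro _ ⟨V, hVm, rfl⟩
    exact (hV1 V hVm.1).preimage hf.continuous
  · rw [eq_univ_iff_forall]
    intro y
    obtain ⟨V, hVm, hy⟩ := mem_sUnion.1 (hV2 ▸ mem_univ (f y))
    exact ⟨_, ⟨V, ⟨hVm, ⟨y, hy⟩⟩, rfl⟩, hy⟩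
  · rintro _ ⟨V, ⟨hVm, y, hy⟩, rfl⟩
    obtain ⟨V', hV', hsub⟩ := hV3 V hVm
    rcases hV' with ⟨_, U, hUm, hVU⟩ | hV'
    · exact ⟨U, hUm, fun y hy => hVU (hsub hy)⟩
    · rw [hV'] at hsub
      exact absurd (mem_range_self y) (hsub hy)
  · intro y
    refine le_trans ?_ (hV4 (f y))
    refine le_trans (encard_le_encard ?_) (encard_image_le (fun V => f ⁻¹' V) _)
    rintro _ ⟨⟨V, hVm, rfl⟩, hy⟩
    exact ⟨V, ⟨hVm.1, hy⟩, rfl⟩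

lemma not_dimLE_zero {Y : Type u} [TopologicalSpace Y] [Nonempty Y] : ¬ DimLE (Y × ℝ) 0 := by
  intro h
  obtain ⟨y⟩ := ‹Nonempty Y›
  obtain ⟨𝒱, hV1, hV2, hV3, hV4⟩ := h {{p | p.2 < 1}, {p | 0 < p.2}}
    (by
      rintro U (rfl | rfl)
      · exact isOpen_lt continuous_snd continuous_const
      · exact isOpen_lt continuous_const continuous_snd)
    (by
      rw [eq_univ_iff_forall]
      rintro ⟨y, t⟩
      by_cases ht : t < 1
      · exact ⟨_, Or.inl rfl, ht⟩
      · exact ⟨_, Or.inr rfl, by show 0 < t; linarith⟩)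
  have huniq : ∀ p, ∀ V ∈ 𝒱, ∀ V' ∈ 𝒱, p ∈ V → p ∈ V' → V = V' := by
    intro p V hV V' hV' h1 h2
    have := hV4 p
    simp only [Nat.cast_zero, zero_add] at this
    exact encard_le_one_iff.1 this V V' ⟨hV, h1⟩ ⟨hV', h2⟩
  obtain ⟨V, hVm, h0⟩ := mem_sUnion.1 (hV2 ▸ mem_univ (y, (0:ℝ)))
  have hcl : IsClopen ((fun t : ℝ => (y, t)) ⁻¹' V) := by
    constructor
    · rw [← isOpen_compl_iff, isOpen_iff_mem_nhds]
      intro t ht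
      obtain ⟨V', hV', h1⟩ := mem_sUnion.1 (hV2 ▸ mem_univ (y, t))
      have ho : IsOpen ((fun t : ℝ => (y, t)) ⁻¹' V') := (hV1 V' hV').preimage (by fun_prop)
      refine Filter.mem_of_superset (ho.mem_nhds h1) ?_
      intro s hs hs'
      have := huniq _ V' hV' V hVm hs hs'
      rw [this] at h1
      exact ht h1
    · exact (hV1 V hVm).preimage (by fun_prop)
  have huniv := hcl.eq_univ ⟨0, h0⟩
  have h1 : (y, (1:ℝ)) ∈ V := by
    have : (1:ℝ) ∈ (fun t : ℝ => (y, t)) ⁻¹' V := huniv ▸ mem_univ _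
    exact this
  obtain ⟨U, hU, hsub⟩ := hV3 V hVm
  rcases hU with rfl | rfl
  · have := hsub h1; simp at this
  · have := hsub h0; simp at this

lemma colored_refinement {Y : Type u} [MetricSpace Y] {n : ℕ} (h : DimLE Y n) (𝒰 : Set (Set Y))
    (hU : ∀ U ∈ 𝒰, IsOpen U) (hc : ⋃₀ 𝒰 = univ) :
    ∃ (κ : Type u) (col : κ → Fin (n + 1)) (Q : κ → Set Y), (∀ v, IsOpen (Q v)) ∧
      (∀ y, ∃ v, y ∈ Q v) ∧ (∀ v, ∃ U ∈ 𝒰, Q v ⊆ U) ∧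
      ∀ v w, col v = col w → v ≠ w → Disjoint (Q v) (Q w) := by
  classical
  obtain ⟨𝒱, hV1, hV2, hV3, hV4⟩ := h 𝒰 hU hc
  obtain ⟨μ, hμ⟩ := PartitionOfUnity.exists_isSubordinate (isClosed_univ (X := Y))
    (fun V : 𝒱 => (V : Set Y)) (fun V => hV1 V V.2) (by rw [← sUnion_eq_iUnion, hV2])
  have hsup : ∀ V y, 0 < μ V y → y ∈ (V : Set Y) := fun V y hy =>
    hμ V (subset_tsupport _ (by exact hy.ne'))
  let star : Finset 𝒱 → Set Y := fun r =>
    {y | (∀ V ∈ r, 0 < μ V y) ∧ ∀ V ∈ r, ∀ V', V' ∉ r → μ V' y < μ V y}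
  refine ⟨{r : Finset 𝒱 // r.Nonempty ∧ r.card ≤ n + 1},
    fun r => ⟨r.1.card - 1, by have := r.2.1.card_pos; have := r.2.2; omega⟩,
    fun r => star r.1, ?_, ?_, ?_, ?_⟩
  · rintro ⟨r, hr, hr'⟩
    rw [isOpen_iff_mem_nhds]
    rintro y ⟨hy1, hy2⟩
    obtain ⟨I, hI⟩ := μ.exists_finset_nhds' y
    have e1 : ∀ᶠ z in nhds y, ∀ V ∈ r, 0 < μ V z :=
      (Finset.eventually_all r).2 fun V hV => (μ V).continuous.continuousAt.eventually (lt_mem_nhds (hy1 V hV))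
    have e2 : ∀ᶠ z in nhds y, ∀ V ∈ r, ∀ V' ∈ (μ.fintsupport y).filter (· ∉ r), μ V' z < μ V z := by
      refine (Finset.eventually_all r).2 fun V hV => (Finset.eventually_all _).2 fun V' hV' => ?_
      exact (μ V').continuous.continuousAt.eventually_lt (μ V).continuous.continuousAt
        (hy2 V hV V' (Finset.mem_filter.1 hV').2)
    filter_upwards [e1, e2, μ.eventually_finsupport_subset y] with z h1 h2 h3
    refine ⟨h1, fun V hV V' hV' => ?_⟩
    by_cases hm : V' ∈ μ.fintsupport y
    · exact h2 V hV V' (Finset.mem_filter.2 ⟨hm, hV'⟩)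
    · have : V' ∉ μ.finsupport z := fun hh => hm (h3 hh)
      rw [PartitionOfUnity.mem_finsupport, Function.mem_support, not_not] at this
      rw [this]; exact h1 V hV
  · intro y
    obtain ⟨V0, hV0⟩ := μ.exists_pos (mem_univ y)
    have hne : (μ.finsupport y).Nonempty := ⟨V0, by
      rw [PartitionOfUnity.mem_finsupport]; exact hV0.ne'⟩
    obtain ⟨Vm, hVm, hmax⟩ := Finset.exists_max_image (μ.finsupport y) (fun V => μ V y) hne
    have hmax' : ∀ V, μ V y ≤ μ Vm y := by
      intro V
      by_cases hV : V ∈ μ.finsupport y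
      · exact hmax V hV
      · rw [PartitionOfUnity.mem_finsupport, Function.mem_support, not_not] at hV
        rw [hV]; exact μ.nonneg _ _
    have hpos : 0 < μ Vm y := hV0.trans_le (hmax' V0)
    let r := (μ.finsupport y).filter (fun V => μ V y = μ Vm y)
    have hr : ∀ V, V ∈ r ↔ μ V y = μ Vm y := by
      intro V
      simp only [r, Finset.mem_filter, and_iff_right_iff_imp, PartitionOfUnity.mem_finsupport]
      intro hV
      rw [Function.mem_support, hV]; exact hpos.ne'
    refine ⟨⟨r, ⟨Vm, (hr Vm).2 rfl⟩, ?_⟩, ?_, ?_⟩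
    · have h1 : ((r.image Subtype.val : Finset (Set Y)) : Set (Set Y)).encard ≤ (n : ℕ∞) + 1 := by
        refine le_trans (encard_le_encard ?_) (hV4 y)
        intro V hV
        simp only [Finset.coe_image, mem_image, Finset.mem_coe] at hV
        obtain ⟨V', hV', rfl⟩ := hV
        exact ⟨V'.2, hsup V' y (by rw [(hr V').1 hV']; exact hpos)⟩
      rw [encard_coe_eq_coe_finsetCard, Finset.card_image_of_injective _ Subtype.val_injective] at h1
      exact_mod_cast h1
    · intro V hV
      rw [(hr V).1 hV]; exact hpos
    · intro V hV V' hV'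
      rw [(hr V).1 hV]
      exact lt_of_le_of_ne (hmax' V') (fun hh => hV' ((hr V').2 hh))
  · rintro ⟨r, ⟨V, hV⟩, hr'⟩
    obtain ⟨U, hUm, hsub⟩ := hV3 V V.2
    exact ⟨U, hUm, fun y hy => hsub (hsup V y (hy.1 V hV))⟩
  · rintro ⟨r, hr, hr'⟩ ⟨s, hs, hs'⟩ hcol hne
    rw [Set.disjoint_left]
    intro y hy1 hy2
    have hcard : r.card = s.card := by
      have h1 := hr.card_pos
      have h2 := hs.card_pos
      have h3 : r.card - 1 = s.card - 1 := congrArg Fin.val hcol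
      omega
    have hne' : r ≠ s := fun hh => hne (Subtype.ext hh)
    have h1 : ¬ r ⊆ s := fun hh => hne' (Finset.eq_of_subset_of_card_le hh hcard.ge)
    have h2 : ¬ s ⊆ r := fun hh => hne' (Finset.eq_of_subset_of_card_le hh hcard.le).symm
    obtain ⟨V, hV, hV'⟩ := Finset.not_subset.1 h1
    obtain ⟨W, hW, hW'⟩ := Finset.not_subset.1 h2
    exact lt_asymm (hy1.2 V hV W hW') (hy2.2 W hW V hV')

lemma dimLE_of_shrink {Y : Type u} [MetricSpace Y] {m : ℕ} (h : DimLE Y (m + 1))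
    (hs : ∀ U : Fin (m + 1 + 1) → Set Y, (∀ i, IsOpen (U i)) → (∀ y, ∃ i, y ∈ U i) →
      ∃ P : Fin (m + 1 + 1) → Set Y, (∀ i, IsOpen (P i)) ∧ (∀ i, P i ⊆ U i) ∧
        (∀ y, ∃ i, y ∈ P i) ∧ ∀ y, ∃ i, y ∉ P i) : DimLE Y m := by
  classical
  intro 𝒰 hU hc
  obtain ⟨κ, col, Q, hQ1, hQ2, hQ3, hQ4⟩ := colored_refinement h 𝒰 hU hc
  obtain ⟨P, hP1, hP2, hP3, hP4⟩ := hs (fun i => ⋃ v ∈ {v | col v = i}, Q v)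
    (fun i => isOpen_biUnion fun v _ => hQ1 v) (fun y => by
      obtain ⟨v, hv⟩ := hQ2 y
      exact ⟨col v, mem_biUnion (show v ∈ {w | col w = col v} from rfl) hv⟩)
  refine ⟨range fun v => Q v ∩ P (col v), ?_, ?_, ?_, ?_⟩
  · rintro _ ⟨v, rfl⟩
    exact (hQ1 v).inter (hP1 _)
  · rw [eq_univ_iff_forall]
    intro y
    obtain ⟨i, hi⟩ := hP3 y
    have := hP2 i hi
    simp only [mem_iUnion, mem_setOf_eq, exists_prop] at this
    obtain ⟨v, rfl, hv⟩ := this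
    exact ⟨_, ⟨v, rfl⟩, hv, hi⟩
  · rintro _ ⟨v, rfl⟩
    obtain ⟨U, hUm, hsub⟩ := hQ3 v
    exact ⟨U, hUm, fun y hy => hsub hy.1⟩
  · intro y
    obtain ⟨i, hi⟩ := hP4 y
    let S : Set κ := {v | y ∈ Q v ∩ P (col v)}
    have h1 : {V | V ∈ range (fun v => Q v ∩ P (col v)) ∧ y ∈ V} ⊆ (fun v => Q v ∩ P (col v)) '' S := by
      rintro _ ⟨⟨v, rfl⟩, hy⟩
      exact ⟨v, hy, rfl⟩
    refine (encard_le_encard h1).trans ((encard_image_le _ _).trans ?_)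
    have hinj : InjOn col S := by
      intro v hv w hw hvw
      by_contra hne
      exact Set.disjoint_left.1 (hQ4 v w hvw hne) hv.1 hw.1
    rw [← hinj.encard_image]
    have h2 : col '' S ⊆ ((Finset.univ.erase i : Finset (Fin (m + 1 + 1))) : Set _) := by
      rintro _ ⟨v, hv, rfl⟩
      simp only [Finset.coe_erase, Finset.coe_univ, mem_diff, mem_univ, mem_singleton_iff, true_and]
      rintro rfl
      exact hi hv.2
    refine (encard_le_encard h2).trans ?_
    rw [encard_coe_eq_coe_finsetCard, Finset.card_erase_of_mem (Finset.mem_univ _)]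
    simp

end DimBasics

section Cochain

lemma det_sum_update {n : ℕ} (M : Matrix (Fin n) (Fin n) ℤ) (w : Fin n → ℤ)
    (h : (∃ k, M k = w) ∨ ∃ k l, k ≠ l ∧ M k = M l) :
    ∑ a, (M.updateRow a w).det = M.det := by
  classical
  rcases h with ⟨k, hk⟩ | ⟨k, l, hkl, hM⟩
  · rw [Finset.sum_eq_single k]
    · rw [← hk, Matrix.updateRow_eq_self]
    · intro b _ hb
      apply Matrix.det_zero_of_row_eq hb
      rw [Matrix.updateRow_self, Matrix.updateRow_ne hb.symm, hk]
    · intro h; exact absurd (Finset.mem_univ _) h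
  · have h0 : M.det = 0 := Matrix.det_zero_of_row_eq hkl hM
    rw [h0]
    have h1 : ∑ a, (M.updateRow a w).det = (M.updateRow k w).det + (M.updateRow l w).det := by
      apply Finset.sum_eq_add k l hkl
      · intro c _ hc
        apply Matrix.det_zero_of_row_eq hkl
        rw [Matrix.updateRow_ne hc.1.symm, Matrix.updateRow_ne hc.2.symm, hM]
      · intro h; exact absurd (Finset.mem_univ _) h
      · intro h; exact absurd (Finset.mem_univ _) h
    rw [h1]
    have h2 : M.updateRow l w = (M.updateRow k w).submatrix (Equiv.swap k l) id := by
      ext i j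
      simp only [Matrix.submatrix_apply, id]
      by_cases hi : i = l
      · subst hi; simp [Matrix.updateRow_self]
      · by_cases hi' : i = k
        · subst hi'
          rw [Equiv.swap_apply_left, Matrix.updateRow_ne hi, Matrix.updateRow_ne hkl.symm, hM]
        · rw [Equiv.swap_apply_of_ne_of_ne hi' hi, Matrix.updateRow_ne hi, Matrix.updateRow_ne hi']
    rw [h2, Matrix.det_permute, Equiv.Perm.sign_swap hkl]
    simp

/-- The intermediate state matrix. -/
def stMat {ι : Type*} {n : ℕ} (ν : ι → ℕ → (Fin (n + 1) → ℤ)) (i k : ℕ) (s : Fin (n + 1) → ι) :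
    Matrix (Fin (n + 1)) (Fin (n + 1)) ℤ :=
  fun l => ν (s l) (if l.val < k then i + 1 else i)

lemma cochain {ι : Type*} {n : ℕ} (coarse : Fin (n + 1) → ι) (ν : ι → ℕ → (Fin (n + 1) → ℤ))
    (hfin : ∀ v, ∃ N, ∀ i ≥ N, ν v i = ν v N)
    (hcoarse : ∀ k i, ν (coarse k) i = Pi.single k 1) :
    ∃ C : Fin (n + 1) → (Fin (n + 1) → ι) → ℤ,
      (∀ j s s', (∀ k, k ≠ j → s k = s' k) → C j s = C j s') ∧
      (∀ j s, (∀ k, k ≠ j → s k = coarse k) → C j s = 0) ∧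
      ∀ s, (∀ k, ν (s k) 0 = Pi.single k 1) →
        (∀ (i : ℕ) (k : Fin (n + 1)),
          ∑ a, ((stMat ν i k s).updateRow a (ν (s k) (i + 1))).det = (stMat ν i k s).det) →
        (∃ N, ∀ i ≥ N, (stMat ν i 0 s).det = 0) → ∑ j, C j s = 1 := by
  classical
  choose Nf hNf using hfin
  let T : Fin (n + 1) → ℕ → Fin (n + 1) → (Fin (n + 1) → ι) → ℤ := fun j i k s =>
    ((stMat ν i k s).updateRow j (ν (s k) (i + 1))).det
  let B : Fin (n + 1) → (Fin (n + 1) → ι) → ℕ := fun j s => ∑ k ∈ Finset.univ.erase j, Nf (s k)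
  let C : Fin (n + 1) → (Fin (n + 1) → ι) → ℤ := fun j s =>
    ∑ i ∈ Finset.range (B j s), ∑ k ∈ Finset.univ.erase j, T j i k s
  have hT0 : ∀ j i k s, k ≠ j → ν (s k) (i + 1) = ν (s k) i → T j i k s = 0 := by
    intro j i k s hkj h
    apply Matrix.det_zero_of_row_eq hkj
    rw [Matrix.updateRow_self, Matrix.updateRow_ne hkj, h]
    simp [stMat]
  refine ⟨C, ?_, ?_, ?_⟩
  · intro j s s' h
    have hB : B j s = B j s' := Finset.sum_congr rfl fun k hk => by
      rw [h k (Finset.ne_of_mem_erase hk)]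
    simp only [C]
    rw [hB]
    refine Finset.sum_congr rfl fun i _ => Finset.sum_congr rfl fun k hk => ?_
    have hk' := Finset.ne_of_mem_erase hk
    simp only [T]
    congr 1
    ext l m
    by_cases hl : l = j
    · subst hl; rw [Matrix.updateRow_self, Matrix.updateRow_self, h k hk']
    · rw [Matrix.updateRow_ne hl, Matrix.updateRow_ne hl]; simp only [stMat]; rw [h l hl]
  · intro j s h
    refine Finset.sum_eq_zero fun i _ => Finset.sum_eq_zero fun k hk => ?_
    have hk' := Finset.ne_of_mem_erase hk
    apply hT0 _ _ _ _ hk'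
    rw [h k hk', hcoarse, hcoarse]
  · intro s h0 hstep ⟨N0, hN0⟩
    let N := N0 + ∑ k, Nf (s k)
    have hCN : ∀ j, C j s = ∑ i ∈ Finset.range N, ∑ k ∈ Finset.univ.erase j, T j i k s := by
      intro j
      apply Finset.sum_subset
      · apply Finset.range_mono
        have : B j s ≤ ∑ k, Nf (s k) :=
          Finset.sum_le_sum_of_subset (Finset.erase_subset _ _)
        simp only [N]; omega
      · intro i _ hi
        rw [Finset.mem_range, not_lt] at hi
        refine Finset.sum_eq_zero fun k hk => ?_
        have hk' := Finset.ne_of_mem_erase hk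
        have h1 : Nf (s k) ≤ i := le_trans
          (Finset.single_le_sum (f := fun k => Nf (s k)) (fun _ _ => Nat.zero_le _) hk) hi
        apply hT0 _ _ _ _ hk'
        rw [hNf _ _ h1, hNf _ _ (h1.trans (Nat.le_succ i))]
    have hupd : ∀ i (k : Fin (n + 1)),
        (stMat ν i k s).updateRow k (ν (s k) (i + 1)) = stMat ν i (k + 1 : ℕ) s := by
      intro i k
      ext l m
      by_cases hl : l = k
      · subst hl; rw [Matrix.updateRow_self]; simp [stMat]
      · rw [Matrix.updateRow_ne hl]
        simp only [stMat]
        have : (l.val < k.val) ↔ l.val < k.val + 1 := by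
          have : l.val ≠ k.val := fun hh => hl (Fin.ext hh)
          omega
        simp only [this]
    have hsum : ∀ i (k : Fin (n + 1)), ∑ j ∈ Finset.univ.erase k, T j i k s
        = (stMat ν i k s).det - (stMat ν i (k + 1 : ℕ) s).det := by
      intro i k
      have h1 := hstep i k
      rw [← Finset.add_sum_erase _ _ (Finset.mem_univ k), hupd] at h1
      simp only [T]
      linarith
    have hlev : ∀ i, ∑ k : Fin (n + 1), ∑ j ∈ Finset.univ.erase k, T j i k s
        = (stMat ν i 0 s).det - (stMat ν (i + 1) 0 s).det := by
      intro i
      rw [Finset.sum_congr rfl fun k _ => hsum i k]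
      rw [Fin.sum_univ_eq_sum_range (fun k => (stMat ν i k s).det - (stMat ν i (k + 1) s).det) (n + 1)]
      rw [Finset.sum_range_sub']
      congr 2
      ext l m
      show ν (s l) (if l.val < n + 1 then i + 1 else i) m
        = ν (s l) (if l.val < 0 then i + 1 + 1 else i + 1) m
      rw [if_pos l.2, if_neg (Nat.not_lt_zero _)]
    rw [Finset.sum_congr rfl fun j _ => hCN j, Finset.sum_comm]
    have hswap : ∀ i, ∑ j : Fin (n + 1), ∑ k ∈ Finset.univ.erase j, T j i k s
        = ∑ k : Fin (n + 1), ∑ j ∈ Finset.univ.erase k, T j i k s := by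
      intro i
      apply Finset.sum_comm'
      intro x y
      simp only [Finset.mem_univ, Finset.mem_erase, true_and, and_true]
      exact ne_comm
    rw [Finset.sum_congr rfl fun i _ => (hswap i).trans (hlev i), Finset.sum_range_sub',
      hN0 N (by simp only [N]; omega)]
    have : stMat ν 0 0 s = 1 := by
      ext l m
      simp only [stMat, Nat.not_lt_zero, if_false, h0]
      rw [Matrix.one_apply, Pi.single_apply]
      simp [eq_comm]
    rw [this]; simp

end Cochain

section Setup

universe u

lemma time_grid {Y : Type u} [MetricSpace Y] (𝒲 : Set (Set (Y × ℝ))) (hW : ∀ W ∈ 𝒲, IsOpen W)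
    (hc : ⋃₀ 𝒲 = univ) :
    ∃ T : ℕ → Y → ℝ, (∀ y, T 0 y = 0) ∧ ∀ y0, ∃ V, IsOpen V ∧ y0 ∈ V ∧ ∃ W : ℕ → Set (Y × ℝ),
      (∀ i, W i ∈ 𝒲) ∧ (∀ i, ∀ y ∈ V, (y, T i y) ∈ W i ∧ (y, T (i + 1) y) ∈ W i) ∧
      ∃ N, ∀ i ≥ N, W i = W N ∧ ∀ y ∈ V, T i y = 1 := by
  have hδ : ∃ δ : C(Y, ℝ), ∀ y, δ y ∈ {r : ℝ | 0 < r ∧ ∀ τ ∈ Icc (0:ℝ) 1, ∃ W ∈ 𝒲,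
      Metric.ball (y, τ) r ⊆ W} := by
    apply exists_continuous_forall_mem_convex_of_local_const
    · intro y
      apply Set.OrdConnected.convex
      constructor
      rintro r ⟨hr, hr2⟩ r' ⟨hr', hr2'⟩ q ⟨hq, hq'⟩
      refine ⟨hr.trans_le hq, fun τ hτ => ?_⟩
      obtain ⟨W, hWm, hsub⟩ := hr2' τ hτ
      exact ⟨W, hWm, (Metric.ball_subset_ball hq').trans hsub⟩
    · intro y
      have hcomp : IsCompact ((fun τ : ℝ => (y, τ)) '' Icc 0 1) :=
        isCompact_Icc.image (by fun_prop)
      obtain ⟨r, hr, hrr⟩ := lebesgue_number_lemma_of_metric_sUnion hcomp hW (by rw [hc]; simp)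
      refine ⟨r / 2, ?_⟩
      filter_upwards [Metric.ball_mem_nhds y (half_pos hr)] with z hz
      refine ⟨half_pos hr, fun τ hτ => ?_⟩
      obtain ⟨W, hWm, hsub⟩ := hrr (y, τ) ⟨τ, hτ, rfl⟩
      refine ⟨W, hWm, fun p hp => hsub ?_⟩
      rw [Metric.mem_ball, Prod.dist_eq, max_lt_iff] at hp ⊢
      rw [Metric.mem_ball] at hz
      simp only at hp ⊢
      exact ⟨by linarith [dist_triangle p.1 z y], by linarith⟩
  obtain ⟨δ, hδ⟩ := hδ
  let T : ℕ → Y → ℝ := fun i y => min 1 (i * (δ y / 4))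
  have hT01 : ∀ i y, T i y ∈ Icc (0:ℝ) 1 := fun i y =>
    ⟨le_min zero_le_one (mul_nonneg (Nat.cast_nonneg i) (by linarith [(hδ y).1])), min_le_left _ _⟩
  refine ⟨T, fun y => by simp [T], fun y0 => ?_⟩
  have hpos := (hδ y0).1
  set d := δ y0 with hd
  choose w hw1 hw2 using (hδ y0).2
  obtain ⟨N, hN⟩ := exists_nat_gt (8 / d)
  have hNpos : (0:ℝ) < N := lt_trans (by positivity) hN
  rw [div_lt_iff₀ hpos] at hN
  let ε := min (d / 2) (d / (2 * N))
  have hε : 0 < ε := lt_min (by linarith) (by positivity)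
  have hTN : ∀ y, |δ y - d| < ε → ∀ i ≥ N, T i y = 1 := by
    intro y hy i hi
    have h1 : |δ y - d| < d / 2 := hy.trans_le (min_le_left _ _)
    have h2 := (abs_lt.1 h1).1
    have h3 : (N:ℝ) ≤ i := by exact_mod_cast hi
    apply min_eq_left
    nlinarith
  have hTd : ∀ y, |δ y - d| < ε → ∀ i, |T i y - T i y0| < d / 4 := by
    intro y hy i
    by_cases hi : N ≤ i
    · rw [hTN y hy i hi, hTN y0 (by simpa [← hd] using hε) i hi]; simpa using hpos
    · push Not at hi
      have h3 : (i:ℝ) ≤ N := by exact_mod_cast hi.le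
      have h1 : |δ y - d| < d / (2 * N) := hy.trans_le (min_le_right _ _)
      rw [lt_div_iff₀ (by positivity)] at h1
      have h2 := abs_min_sub_min_le_max (1:ℝ) (i * (δ y / 4)) 1 (i * (δ y0 / 4))
      rw [sub_self, abs_zero, max_eq_right (abs_nonneg _)] at h2
      refine h2.trans_lt ?_
      rw [← mul_sub, abs_mul, abs_of_nonneg (Nat.cast_nonneg i), ← sub_div, abs_div]
      rw [abs_of_pos (show (0:ℝ) < 4 by norm_num)]
      nlinarith [abs_nonneg (δ y - δ y0)]
  have hstep : ∀ i y, |T (i + 1) y - T i y| ≤ δ y / 4 := by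
    intro i y
    have h2 := abs_min_sub_min_le_max (1:ℝ) ((i + 1 : ℕ) * (δ y / 4)) 1 (i * (δ y / 4))
    rw [sub_self, abs_zero, max_eq_right (abs_nonneg _)] at h2
    refine h2.trans ?_
    rw [← sub_mul]; push_cast
    rw [add_sub_cancel_left, one_mul, abs_of_pos (by linarith [(hδ y).1])]
  refine ⟨Metric.ball y0 d ∩ {y | |δ y - d| < ε}, ?_, ⟨Metric.mem_ball_self hpos, ?_⟩,
    fun i => w (T i y0) (hT01 i y0), fun i => hw1 _ _, ?_, N, ?_⟩
  · exact Metric.isOpen_ball.inter (isOpen_lt (by fun_prop) continuous_const)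
  · simpa [← hd] using hε
  · rintro i y ⟨hy1, hy2⟩
    have hy2' : |δ y - d| < ε := hy2
    have h1 := hTd y hy2' i
    have h2 := hstep i y
    have h3 := (abs_lt.1 (hy2'.trans_le (min_le_left _ _))).2
    constructor
    · apply hw2
      rw [Metric.mem_ball, Prod.dist_eq, max_lt_iff]
      refine ⟨hy1, ?_⟩
      rw [Real.dist_eq]; linarith
    · apply hw2
      rw [Metric.mem_ball, Prod.dist_eq, max_lt_iff]
      refine ⟨hy1, ?_⟩
      simp only
      rw [Real.dist_eq]
      have := abs_sub_le (T (i + 1) y) (T i y) (T i y0)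
      linarith
  · intro i hi
    refine ⟨?_, fun y hy => hTN y hy.2 i hi⟩
    have h0 : |δ y0 - d| < ε := by simpa [← hd] using hε
    have : T i y0 = T N y0 := by rw [hTN y0 h0 i hi, hTN y0 h0 N le_rfl]
    have key : ∀ (p q : ℝ) (hp : p ∈ Icc (0:ℝ) 1) (hq : q ∈ Icc (0:ℝ) 1), p = q → w p hp = w q hq := by
      rintro p q hp hq rfl; rfl
    exact key _ _ _ _ this

end Setup

section Setup2

universe u

lemma det_step {n : ℕ} {α : Type*} (M : Matrix (Fin n) (Fin n) ℤ) (w : Fin n → ℤ)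
    (G : Option (Fin n) → α) (g : α → Fin n → ℤ) (hn : w = g (G none))
    (hs : ∀ k, M k = g (G (some k))) (hG : ¬ Function.Injective G) :
    ∑ a, (M.updateRow a w).det = M.det := by
  apply det_sum_update
  simp only [Function.Injective, not_forall] at hG
  obtain ⟨a, b, hab, hne⟩ := hG
  match a, b with
  | none, none => exact absurd rfl hne
  | none, some k => left; exact ⟨k, by rw [hs, hn, hab]⟩
  | some k, none => left; exact ⟨k, by rw [hs, hn, hab]⟩
  | some k, some l =>
    right; exact ⟨k, l, fun h => hne (by rw [h]), by rw [hs, hs, hab]⟩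

lemma det_zero_of_missing {n : ℕ} (S : Fin n → Prop) (j0 : Fin n) (hj0 : ¬ S j0)
    (M : Matrix (Fin n) (Fin n) ℤ)
    (h : ∀ k, M k = 0 ∨ ∃ j, S j ∧ M k = Pi.single j 1) : M.det = 0 := by
  apply Matrix.det_eq_zero_of_column_eq_zero j0
  intro k
  rcases h k with h | ⟨j, hj, h⟩
  · rw [h]; rfl
  · rw [h, Pi.single_eq_of_ne]
    rintro rfl; exact hj0 hj

lemma setup_data {Y : Type u} [MetricSpace Y] {n : ℕ} (hY : DimLE Y n) (hYR : DimLE (Y × ℝ) n)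
    (U : Fin (n + 1) → Set Y) (hU : ∀ i, IsOpen (U i)) (hUc : ∀ y, ∃ i, y ∈ U i) :
    ∃ (ι : Type u) (col : ι → Fin (n + 1)) (coarse : Fin (n + 1) → ι) (V : ι → Set Y)
      (C : Fin (n + 1) → (Fin (n + 1) → ι) → ℤ),
      (∀ k, col (coarse k) = k) ∧ (∀ v, IsOpen (V v)) ∧ (∀ y, ∃ v, y ∈ V v) ∧
      (∀ v w, col v = col w → v ≠ w → Disjoint (V v) (V w)) ∧
      (∀ k, V (coarse k) ⊆ U k) ∧ (∀ v, v ∉ range coarse → ∀ k, V v ⊆ U k) ∧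
      (∀ j s s', (∀ k, k ≠ j → s k = s' k) → C j s = C j s') ∧
      (∀ j s, (∀ k, k ≠ j → s k = coarse k) → C j s = 0) ∧
      ∀ s, (∀ k, col (s k) = k) → (∃ y, ∀ k, y ∈ V (s k)) → ∑ j, C j s = 1 := by
  classical
  obtain ⟨U1, hU1c, hU1o, hU1⟩ := exists_iUnion_eq_closure_subset hU (fun _ => Set.toFinite _)
    (by rw [eq_univ_iff_forall]; simpa using hUc)
  obtain ⟨U0, hU0c, hU0o, hU0⟩ := exists_iUnion_eq_closure_subset hU1o (fun _ => Set.toFinite _) hU1c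
  have hU01 : ∀ i, U0 i ⊆ U1 i := fun i => subset_closure.trans (hU0 i)
  have hU1U : ∀ i, U1 i ⊆ U i := fun i => subset_closure.trans (hU1 i)
  have hU0c' : ∀ y, ∃ i, y ∈ U0 i := fun y => mem_iUnion.1 (hU0c ▸ mem_univ y)
  let O1 : Set Y := ⋂ i, U1 i
  let O : Set Y := ⋂ i, U i
  have hOo : IsOpen O := isOpen_iInter_of_finite hU
  obtain ⟨H, hHo, hH1, hH2⟩ := normal_exists_closure_subset (isClosed_closure (s := O1)) hOo
    (subset_iInter fun i => (closure_mono (iInter_subset _ i)).trans (hU1 i))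
  let P : Set Y := (closure H)ᶜ
  have hPo : IsOpen P := isClosed_closure.isOpen_compl
  have hPH : Disjoint P H := disjoint_compl_left.mono_right subset_closure
  -- the cover of the product
  obtain ⟨𝒲, hW1, hW2, hW3, hW4⟩ := hYR (insert (univ ×ˢ Ioi (0:ℝ)) (range fun i => U0 i ×ˢ Iio (1:ℝ)))
    (by
      rintro _ (rfl | ⟨i, rfl⟩)
      · exact isOpen_univ.prod isOpen_Ioi
      · exact (hU0o i).prod isOpen_Iio)
    (by
      rw [eq_univ_iff_forall]
      rintro ⟨y, t⟩
      by_cases ht : 0 < t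
      · exact ⟨_, Or.inl rfl, mem_univ _, ht⟩
      · obtain ⟨i, hi⟩ := hU0c' y
        exact ⟨_, Or.inr ⟨i, rfl⟩, hi, by show t < 1; linarith⟩)
  obtain ⟨T, hT0, hT⟩ := time_grid 𝒲 hW1 hW2
  let lab : Set (Y × ℝ) → (Fin (n + 1) → ℤ) := fun W =>
    if h : ∃ i, W ⊆ U0 i ×ˢ Iio (1:ℝ) then Pi.single h.choose 1 else 0
  have hlab1 : ∀ W y t, (y, t) ∈ W → lab W = 0 ∨ ∃ j, y ∈ U1 j ∧ lab W = Pi.single j 1 := by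
    intro W y t hy
    by_cases h : ∃ i, W ⊆ U0 i ×ˢ Iio (1:ℝ)
    · right
      refine ⟨h.choose, hU01 _ (h.choose_spec hy).1, ?_⟩
      simp only [lab, dif_pos h]
    · left; simp only [lab, dif_neg h]
  have hlab0 : ∀ W ∈ 𝒲, ∀ y, (y, (0:ℝ)) ∈ W → ∃ j, lab W = Pi.single j 1 := by
    intro W hW y hy
    obtain ⟨G, hG, hsub⟩ := hW3 W hW
    rcases hG with rfl | ⟨i, rfl⟩
    · have := (hsub hy).2; simp at this
    · have h : ∃ i, W ⊆ U0 i ×ˢ Iio (1:ℝ) := ⟨i, hsub⟩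
      exact ⟨h.choose, by simp only [lab, dif_pos h]⟩
  have hlabe : ∀ W y, (y, (1:ℝ)) ∈ W → lab W = 0 := by
    intro W y hy
    have h : ¬ ∃ i, W ⊆ U0 i ×ˢ Iio (1:ℝ) := by
      rintro ⟨i, hi⟩
      have := (hi hy).2; simp at this
    simp only [lab, dif_neg h]
  -- good small sets
  let Good : Set Y → Prop := fun A =>
    (∃ W : ℕ → Set (Y × ℝ), (∀ i, W i ∈ 𝒲) ∧
      (∀ i, ∀ y ∈ A, (y, T i y) ∈ W i ∧ (y, T (i + 1) y) ∈ W i) ∧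
      ∃ N, ∀ i ≥ N, W i = W N ∧ ∀ y ∈ A, T i y = 1) ∧
    (∀ i, (A ∩ U0 i).Nonempty → A ⊆ U1 i) ∧ ((A ∩ P).Nonempty → Disjoint A O1) ∧
    ((A ∩ closure H).Nonempty → A ⊆ O)
  have hGmono : ∀ A B, A ⊆ B → Good B → Good A := by
    rintro A B hAB ⟨⟨W, hw1, hw2, N, hN⟩, h2, h3, h4⟩
    refine ⟨⟨W, hw1, fun i y hy => hw2 i y (hAB hy), N, fun i hi => ⟨(hN i hi).1,
      fun y hy => (hN i hi).2 y (hAB hy)⟩⟩, fun i hi => hAB.trans (h2 i (hi.mono ?_)),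
      fun h => (h3 (h.mono ?_)).mono_left hAB, fun h => hAB.trans (h4 (h.mono ?_))⟩
    all_goals exact inter_subset_inter_left _ hAB
  have hGex : ∀ y, ∃ A, IsOpen A ∧ y ∈ A ∧ Good A := by
    intro y
    obtain ⟨A1, hA1o, hyA1, W, hw1, hw2, N, hN⟩ := hT y
    let B : Fin (n + 1) → Set Y := fun i => if y ∈ closure (U0 i) then U1 i else (closure (U0 i))ᶜ
    have hBo : ∀ i, IsOpen (B i) := by
      intro i; simp only [B]; split_ifs
      · exact hU1o i
      · exact isClosed_closure.isOpen_compl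
    have hyB : ∀ i, y ∈ B i := by
      intro i; simp only [B]; split_ifs with h
      · exact hU0 i h
      · exact h
    let E : Set Y := if y ∈ H then H else (closure O1)ᶜ
    have hEo : IsOpen E := by
      simp only [E]; split_ifs
      · exact hHo
      · exact isClosed_closure.isOpen_compl
    have hyE : y ∈ E := by
      simp only [E]; split_ifs with h
      · exact h
      · exact fun h' => h (hH1 h')
    let F : Set Y := if y ∈ closure H then O else (closure H)ᶜ
    have hFo : IsOpen F := by
      simp only [F]; split_ifs
      · exact hOo
      · exact isClosed_closure.isOpen_compl
    have hyF : y ∈ F := by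
      simp only [F]; split_ifs with h
      · exact hH2 h
      · exact h
    refine ⟨A1 ∩ (⋂ i, B i) ∩ E ∩ F, ((hA1o.inter (isOpen_iInter_of_finite hBo)).inter hEo).inter hFo,
      ⟨⟨⟨hyA1, mem_iInter.2 hyB⟩, hyE⟩, hyF⟩, ⟨W, hw1, fun i z hz => hw2 i z hz.1.1.1, N, fun i hi =>
        ⟨(hN i hi).1, fun z hz => (hN i hi).2 z hz.1.1.1⟩⟩, ?_, ?_, ?_⟩
    · rintro i ⟨z, hz, hz0⟩ x hx
      have hzB := mem_iInter.1 hz.1.1.2 i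
      have hxB := mem_iInter.1 hx.1.1.2 i
      simp only [B] at hzB hxB
      split_ifs at hzB hxB with h
      · exact hxB
      · exact absurd (subset_closure hz0) hzB
    · rintro ⟨z, hz, hzP⟩
      rw [Set.disjoint_left]
      intro x hx hxO
      have hzE := hz.1.2
      have hxE := hx.1.2
      simp only [E] at hzE hxE
      split_ifs at hzE hxE with h
      · exact Set.disjoint_left.1 hPH hzP hzE
      · exact hxE (subset_closure hxO)
    · rintro ⟨z, hz, hzH⟩ x hx
      have hzF := hz.2
      have hxF := hx.2
      simp only [F] at hzF hxF
      split_ifs at hzF hxF with h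
      · exact hxF
      · exact absurd hzH hzF
  obtain ⟨κ, colκ, Q, hQo, hQc, hQs, hQd⟩ := colored_refinement hY {A | IsOpen A ∧ Good A}
    (fun A hA => hA.1) (by
      rw [eq_univ_iff_forall]
      intro y
      obtain ⟨A, h1, h2, h3⟩ := hGex y
      exact ⟨A, ⟨h1, h3⟩, h2⟩)
  have hQg : ∀ v, Good (Q v) := fun v => by
    obtain ⟨A, hA, hsub⟩ := hQs v
    exact hGmono _ _ hsub hA.2
  choose Wf hWf1 hWf2 Nf hNf using fun v => (hQg v).1
  let fine : κ → Prop := fun v => (Q v ∩ closure H).Nonempty ∧ ¬ (Q v ∩ (P ∩ U0 (colκ v))).Nonempty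
  let ι := Fin (n + 1) ⊕ {v : κ // fine v}
  let col : ι → Fin (n + 1) := Sum.elim id (fun v => colκ v.1)
  let Vs : Fin (n + 1) → Set Y := fun i =>
    (P ∩ U0 i) ∪ ⋃ v ∈ {v | colκ v = i ∧ (Q v ∩ (P ∩ U0 i)).Nonempty}, Q v
  have hVsU : ∀ i, Vs i ⊆ U1 i := by
    rintro i y (hy | hy)
    · exact hU01 i hy.2
    · simp only [mem_iUnion] at hy
      obtain ⟨v, ⟨hv1, hv2⟩, hy⟩ := hy
      exact (hQg v).2.1 i (hv2.mono fun z hz => ⟨hz.1, hz.2.2⟩) hy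
  have hVsO : ∀ i, ∀ y ∈ Vs i, y ∉ O1 := by
    rintro i y (hy | hy) hyO
    · exact Set.disjoint_left.1 hPH hy.1 (hH1 (subset_closure hyO))
    · simp only [mem_iUnion] at hy
      obtain ⟨v, ⟨hv1, hv2⟩, hy⟩ := hy
      exact Set.disjoint_left.1 ((hQg v).2.2.1 (hv2.mono fun z hz => ⟨hz.1, hz.2.1⟩)) hy hyO
  let V : ι → Set Y := Sum.elim Vs (fun v => Q v.1)
  let ν : ι → ℕ → (Fin (n + 1) → ℤ) := fun v i => Sum.elim (fun k => Pi.single k 1)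
    (fun v => match i with
      | 0 => Pi.single (colκ v.1) 1
      | i + 1 => lab (Wf v.1 i)) v
  have hνc : ∀ k i, ν (Sum.inl k) i = Pi.single k 1 := fun k i => rfl
  have hν0 : ∀ v, ν v 0 = Pi.single (col v) 1 := by rintro (k | v) <;> rfl
  have hνf : ∀ (v : {v : κ // fine v}) i, ν (Sum.inr v) (i + 1) = lab (Wf v.1 i) := fun v i => rfl
  have hpt : ∀ v i, ∀ y ∈ V v, ν v (i + 1) = 0 ∨ ∃ j, y ∈ U1 j ∧ ν v (i + 1) = Pi.single j 1 := by
    rintro (k | v) i y hy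
    · right; exact ⟨k, hVsU k hy, rfl⟩
    · rw [hνf]
      exact hlab1 _ y _ (hWf2 v.1 i y hy).1
  obtain ⟨C, hC1, hC2, hC3⟩ := cochain (ι := ι) Sum.inl ν (by
      rintro (k | v)
      · exact ⟨0, fun i _ => rfl⟩
      · refine ⟨Nf v.1 + 1, fun i hi => ?_⟩
        obtain ⟨i, rfl⟩ : ∃ j, i = j + 1 := ⟨i - 1, by omega⟩
        rw [hνf, hνf, (hNf v.1 i (by omega)).1]) hνc
  refine ⟨ι, col, Sum.inl, V, C, fun k => rfl, ?_, ?_, ?_, fun k => (hVsU k).trans (hU1U k), ?_,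
    hC1, hC2, ?_⟩
  · rintro (k | v)
    · exact (hPo.inter (hU0o k)).union (isOpen_biUnion fun v _ => hQo v)
    · exact hQo v.1
  · intro y
    by_cases hy : y ∈ closure H
    · obtain ⟨v, hv⟩ := hQc y
      by_cases hf : (Q v ∩ (P ∩ U0 (colκ v))).Nonempty
      · refine ⟨Sum.inl (colκ v), Or.inr ?_⟩
        simp only [mem_iUnion]
        exact ⟨v, ⟨rfl, hf⟩, hv⟩
      · exact ⟨Sum.inr ⟨v, ⟨y, hv, hy⟩, hf⟩, hv⟩
    · obtain ⟨i, hi⟩ := hU0c' y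
      exact ⟨Sum.inl i, Or.inl ⟨hy, hi⟩⟩
  · have haux : ∀ (k : Fin (n + 1)) (v : {v : κ // fine v}), k = colκ v.1 → Disjoint (Vs k) (Q v.1) := by
      rintro k v rfl
      rw [Set.disjoint_left]
      rintro y (hy | hy) hyv
      · exact v.2.2 ⟨y, hyv, hy⟩
      · simp only [mem_iUnion] at hy
        obtain ⟨w, ⟨hw1, hw2⟩, hy⟩ := hy
        by_cases hvw : w = v.1
        · rw [hvw] at hw2
          exact v.2.2 hw2
        · exact Set.disjoint_left.1 (hQd w v.1 hw1 hvw) hy hyv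
    rintro (k | v) (l | w) hcol hne
    · exact absurd (congrArg Sum.inl hcol) hne
    · exact haux k w hcol
    · exact (haux l v hcol.symm).symm
    · exact hQd v.1 w.1 hcol (fun h => hne (congrArg Sum.inr (Subtype.ext h)))
  · rintro (k | v) hv k'
    · exact absurd ⟨k, rfl⟩ hv
    · exact ((hQg v.1).2.2.2 v.2.1).trans (iInter_subset _ k')
  · rintro s hs ⟨y, hy⟩
    apply hC3 s (fun k => by rw [hν0, hs])
    · rintro i k
      rcases i with _ | i
      · -- level zero: pigeonhole on colours
        have h1 : ∀ v, y ∈ V v → ∃ j, ν v 1 = Pi.single j 1 := by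
          rintro (k | v) hv
          · exact ⟨k, rfl⟩
          · have := (hWf2 v.1 0 y hv).1
            rw [hT0] at this
            exact hlab0 _ (hWf1 v.1 0) y this
        choose! j1 hj1 using h1
        refine det_step _ _ (fun o : Option (Fin (n + 1)) => o.elim (j1 (s k))
          (fun l => if l.val < k.val then j1 (s l) else col (s l))) (fun j => Pi.single j 1)
          (hj1 _ (hy k)) ?_ ?_
        · intro l
          simp only [stMat, Option.elim]
          split_ifs
          · exact hj1 _ (hy l)
          · exact hν0 _
        · intro hinj
          have := Fintype.card_le_of_injective _ hinj
          simp at this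
      · by_cases hco : ∃ l k', s l = Sum.inl k'
        · obtain ⟨l, k', hl⟩ := hco
          have hyl := hy l
          rw [hl] at hyl
          have hyO := hVsO k' y hyl
          obtain ⟨j0, hj0⟩ : ∃ j0, y ∉ U1 j0 := by
            by_contra hh
            push Not at hh
            exact hyO (mem_iInter.2 hh)
          have hrow : ∀ l, stMat ν (i + 1) k s l = 0 ∨ ∃ j, y ∈ U1 j ∧
              stMat ν (i + 1) k s l = Pi.single j 1 := by
            intro l
            simp only [stMat]
            split_ifs
            · exact hpt _ _ y (hy l)
            · exact hpt _ _ y (hy l)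
          rw [det_zero_of_missing (fun j => y ∈ U1 j) j0 hj0 _ hrow]
          refine Finset.sum_eq_zero fun a _ => ?_
          apply det_zero_of_missing (fun j => y ∈ U1 j) j0 hj0
          intro l
          by_cases hla : l = a
          · subst hla; rw [Matrix.updateRow_self]; exact hpt _ _ y (hy k)
          · rw [Matrix.updateRow_ne hla]; exact hrow l
        · have hfine : ∀ l, ∃ v, s l = Sum.inr v := by
            intro l
            rcases hsl : s l with k' | v
            · exact absurd ⟨l, k', hsl⟩ hco
            · exact ⟨v, rfl⟩
          choose sv hsv using hfine
          have hyQ : ∀ l, y ∈ Q (sv l).1 := by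
            intro l
            have := hy l
            rw [hsv l] at this
            exact this
          refine det_step _ _ (fun o : Option (Fin (n + 1)) => o.elim (Wf (sv k).1 (i + 1))
            (fun l => if l.val < k.val then Wf (sv l).1 (i + 1) else Wf (sv l).1 i)) lab ?_ ?_ ?_
          · rw [hsv k]; rfl
          · intro l
            simp only [stMat, Option.elim]
            rw [hsv l]
            split_ifs <;> rfl
          · intro hinj
            have h1 := hinj.encard_range
            have h2 := encard_le_encard (s := range fun o : Option (Fin (n + 1)) =>
              o.elim (Wf (sv k).1 (i + 1))
              (fun l => if l.val < k.val then Wf (sv l).1 (i + 1) else Wf (sv l).1 i))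
              (t := {W | W ∈ 𝒲 ∧ (y, T (i + 1) y) ∈ W}) (by
                rintro _ ⟨o, rfl⟩
                rcases o with _ | l
                · exact ⟨hWf1 _ _, (hWf2 _ _ y (hyQ k)).1⟩
                · simp only [Option.elim]
                  split_ifs
                  · exact ⟨hWf1 _ _, (hWf2 _ _ y (hyQ l)).1⟩
                  · exact ⟨hWf1 _ _, (hWf2 _ _ y (hyQ l)).2⟩)
            have h3 := (h1.trans h2).trans (hW4 _)
            rw [ENat.card_eq_coe_fintype_card, Fintype.card_option, Fintype.card_fin] at h3
            have h4 : n + 1 + 1 ≤ n + 1 := by exact_mod_cast h3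
            omega
    · by_cases hf : ∃ l v, s l = Sum.inr v
      · obtain ⟨l, v, hl⟩ := hf
        refine ⟨Nf v.1 + 1, fun i hi => ?_⟩
        obtain ⟨i, rfl⟩ : ∃ j, i = j + 1 := ⟨i - 1, by omega⟩
        apply Matrix.det_eq_zero_of_row_eq_zero l
        intro m
        have hyl := hy l
        rw [hl] at hyl
        have h1 := (hWf2 v.1 i y hyl).1
        rw [(hNf v.1 i (by omega)).2 y hyl] at h1
        simp only [stMat, Nat.not_lt_zero, if_false]
        rw [hl, hνf, hlabe _ y h1]; rfl
      · exfalso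
        have hall : ∀ l, y ∈ Vs l := by
          intro l
          rcases hsl : s l with k' | v
          · have h1 := hs l
            rw [hsl] at h1
            have h2 := hy l
            rw [hsl] at h2
            have h3 : k' = l := h1
            rw [← h3]; exact h2
          · exact absurd ⟨l, v, hsl⟩ hf
        exact hVsO 0 y (hall 0) (mem_iInter.2 fun l => hVsU l (hall l))

end Setup2

section
lemma shrink_one {Y : Type*} [TopologicalSpace Y] {ι : Type*} (col : ι → Fin (1 + 1))
    (coarse : Fin (1 + 1) → ι) (V : ι → Set Y) (C : Fin (1 + 1) → (Fin (1 + 1) → ι) → ℤ)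
    (h1 : ∀ k, col (coarse k) = k) (h2 : ∀ v, IsOpen (V v)) (h3 : ∀ y, ∃ v, y ∈ V v)
    (h4 : ∀ v w, col v = col w → v ≠ w → Disjoint (V v) (V w))
    (h5 : ∀ j s s', (∀ k, k ≠ j → s k = s' k) → C j s = C j s')
    (h6 : ∀ j s, (∀ k, k ≠ j → s k = coarse k) → C j s = 0)
    (h7 : ∀ s, (∀ k, col (s k) = k) → (∃ y, ∀ k, y ∈ V (s k)) → ∑ j, C j s = 1) :
    ∃ P : Fin (1 + 1) → Set Y, (∀ i, IsOpen (P i)) ∧ (∀ y, ∃ i, y ∈ P i) ∧ (∀ y, ∃ i, y ∉ P i) ∧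
      ∀ k, ∀ y ∈ P k, y ∈ V (coarse k) ∨ ∃ v, v ∉ range coarse ∧ y ∈ V v := by
  set α : ι → ℤ := fun v => C 0 ![coarse 0, v] with hα
  set β : ι → ℤ := fun u => C 1 ![u, coarse 1] with hβ
  have hα0 : α (coarse 1) = 0 := h6 _ _ (by intro k hk; fin_cases k <;> simp)
  have hβ0 : β (coarse 0) = 0 := h6 _ _ (by intro k hk; fin_cases k <;> simp)
  have key : ∀ u v y, col u = 0 → col v = 1 → y ∈ V u → y ∈ V v → α v + β u = 1 := by
    intro u v y hu hv hyu hyv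
    have := h7 ![u, v] (by intro k; fin_cases k <;> simp [hu, hv])
      ⟨y, by intro k; fin_cases k <;> simp [hyu, hyv]⟩
    rw [Fin.sum_univ_two] at this
    rw [← this]
    congr 1
    · exact h5 _ _ _ (by intro k hk; fin_cases k <;> simp at hk ⊢)
    · exact h5 _ _ _ (by intro k hk; fin_cases k <;> simp at hk ⊢)
  have uniq : ∀ u v y, col u = col v → y ∈ V u → y ∈ V v → u = v := by
    intro u v y h hu hv
    by_contra hne
    exact (Set.disjoint_left.1 (h4 u v h hne)) hu hv
  have two : ∀ v, col v = 0 ∨ col v = 1 := by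
    intro v
    rcases hc : col v with ⟨a, ha⟩
    have : a = 0 ∨ a = 1 := by omega
    rcases this with rfl | rfl <;> simp
  have fine : ∀ v, v ≠ coarse (col v) → v ∉ range coarse := by
    rintro v hv ⟨k, rfl⟩
    exact hv (by rw [h1])
  let P0 : Set Y := {y | ∃ v, y ∈ V v ∧ ((col v = 0 ∧ β v ≤ 0) ∨ (col v = 1 ∧ 1 ≤ α v))}
  let P1 : Set Y := {y | ∃ v, y ∈ V v ∧ ((col v = 0 ∧ 1 ≤ β v) ∨ (col v = 1 ∧ α v ≤ 0))}
  have op : ∀ p : ι → Prop, IsOpen {y | ∃ v, y ∈ V v ∧ p v} := by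
    intro p
    have : {y | ∃ v, y ∈ V v ∧ p v} = ⋃ v, ⋃ _ : p v, V v := by
      ext y; simp [and_comm]
    rw [this]
    exact isOpen_iUnion fun v => isOpen_iUnion fun _ => h2 v
  refine ⟨![P0, P1], ?_, ?_, ?_, ?_⟩
  · intro i
    fin_cases i
    · exact op _
    · exact op _
  · intro y
    obtain ⟨v, hv⟩ := h3 y
    rcases two v with h | h
    · rcases le_or_gt (β v) 0 with h' | h'
      · exact ⟨0, v, hv, Or.inl ⟨h, h'⟩⟩
      · exact ⟨1, v, hv, Or.inl ⟨h, h'⟩⟩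
    · rcases le_or_gt (α v) 0 with h' | h'
      · exact ⟨1, v, hv, Or.inr ⟨h, h'⟩⟩
      · exact ⟨0, v, hv, Or.inr ⟨h, h'⟩⟩
  · intro y
    by_cases hy : y ∈ P0
    · refine ⟨1, ?_⟩
      rintro ⟨w, hw, hw'⟩
      obtain ⟨v, hv, hv'⟩ := hy
      rcases hv' with ⟨a, b⟩ | ⟨a, b⟩ <;> rcases hw' with ⟨c, d⟩ | ⟨c, d⟩
      · have := uniq v w y (a.trans c.symm) hv hw
        subst this; omega
      · have := key v w y a c hv hw
        omega
      · have := key w v y c a hw hv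
        omega
      · have := uniq v w y (a.trans c.symm) hv hw
        subst this; omega
    · exact ⟨0, hy⟩
  · intro k y hy
    have hc : ∀ v, y ∈ V v → v = coarse k ∨ v ≠ coarse (col v) →
        y ∈ V (coarse k) ∨ ∃ v, v ∉ range coarse ∧ y ∈ V v := by
      rintro v hv (rfl | h)
      · exact Or.inl hv
      · exact Or.inr ⟨v, fine v h, hv⟩
    fin_cases k
    · obtain ⟨v, hv, ⟨a, b⟩ | ⟨a, b⟩⟩ := hy
      · refine hc v hv ?_
        rw [a]; exact em _
      · refine hc v hv (Or.inr ?_)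
        rw [a]; rintro rfl; omega
    · obtain ⟨v, hv, ⟨a, b⟩ | ⟨a, b⟩⟩ := hy
      · refine hc v hv (Or.inr ?_)
        rw [a]; rintro rfl; omega
      · refine hc v hv ?_
        rw [a]; exact em _

lemma exists_lams {Y : Type*} [MetricSpace Y] {ι : Type*} {N : ℕ} (col : ι → Fin N)
    (V : ι → Set Y) (h2 : ∀ v, IsOpen (V v)) (h3 : ∀ y, ∃ v, y ∈ V v) :
    ∃ (lv : ι → Y → ℝ) (lam : Fin N → Y → ℝ), (∀ v, Continuous (lv v)) ∧ (∀ v y, 0 ≤ lv v y) ∧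
      (∀ v, tsupport (lv v) ⊆ V v) ∧ LocallyFinite (fun v => tsupport (lv v)) ∧
      (∀ k, Continuous (lam k)) ∧ (∀ k y, 0 ≤ lam k y) ∧ (∀ y, ∑ k, lam k y = 1) ∧
      ∀ k y, 0 < lam k y ↔ ∃ v, col v = k ∧ 0 < lv v y := by
  classical
  obtain ⟨f, hf⟩ := PartitionOfUnity.exists_isSubordinate (s := univ) isClosed_univ V h2
    (fun y _ => mem_iUnion.2 (h3 y))
  have hfin : ∀ k y, (Function.support fun v => if col v = k then f v y else 0).Finite := by
    intro k y
    refine (f.locallyFinite.point_finite y).subset ?_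
    intro v hv
    simp only [Function.mem_support] at hv
    simp only [mem_setOf_eq, Function.mem_support]
    intro h; apply hv; split_ifs <;> simp [h]
  refine ⟨fun v => f v, fun k y => ∑ᶠ v, if col v = k then f v y else 0,
    fun v => (f v).continuous, fun v y => f.nonneg v y, hf, f.locallyFinite_tsupport, ?_, ?_, ?_, ?_⟩
  · intro k
    refine continuous_finsum (fun v => ?_) (f.locallyFinite.subset ?_)
    · by_cases h : col v = k
      · simpa [h] using (f v).continuous
      · simpa [h] using continuous_const
    · intro v y hy
      simp only [Function.mem_support] at hy ⊢
      intro h; apply hy; split_ifs <;> simp [h]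
  · intro k y
    refine finsum_nonneg fun v => ?_
    split_ifs
    · exact f.nonneg v y
    · exact le_rfl
  · intro y
    have h1 := f.sum_eq_one (mem_univ y)
    have hs : ∀ k, ∑ᶠ v, (if col v = k then f v y else 0) =
        ∑ v ∈ (f.locallyFinite.point_finite y).toFinset, if col v = k then f v y else 0 := by
      intro k
      refine finsum_eq_sum_of_support_subset _ ?_
      intro v hv
      simp only [Function.mem_support] at hv
      simp only [Finite.coe_toFinset, mem_setOf_eq, Function.mem_support]
      intro h; apply hv; split_ifs <;> simp [h]
    rw [finsum_eq_sum_of_support_subset (s := (f.locallyFinite.point_finite y).toFinset) _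
      (by intro v hv; simpa using hv)] at h1
    rw [Finset.sum_congr rfl fun k _ => hs k, Finset.sum_comm, ← h1]
    refine Finset.sum_congr rfl fun v _ => ?_
    simp
  · intro k y
    constructor
    · intro h
      by_contra! hc
      have : ∑ᶠ v, (if col v = k then f v y else 0) = 0 := by
        apply finsum_eq_zero_of_forall_eq_zero
        intro v
        split_ifs with hv
        · exact le_antisymm (hc v hv) (f.nonneg v y)
        · rfl
      exact h.ne' this
    · rintro ⟨v, hv, hp⟩
      refine finsum_pos' (fun w => ?_) ⟨v, by simpa [hv] using hp⟩ (hfin k y)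
      split_ifs
      · exact f.nonneg w y
      · exact le_rfl
end

section
noncomputable def gk (N : ℕ) (k : Fin N) : ℂ :=
  Complex.exp (((2 * (k : ℝ) + 1) * (Real.pi / N) : ℝ) * Complex.I)

lemma gk_eq (N : ℕ) (k : Fin N) : gk N k =
    Complex.exp ((Real.pi / N : ℝ) * Complex.I) * Complex.exp (2 * Real.pi * Complex.I / N) ^ (k : ℕ) := by
  rw [gk, ← Complex.exp_nat_mul, ← Complex.exp_add]
  congr 1
  push_cast
  ring

lemma sum_gk (N : ℕ) (hN : 3 ≤ N) : ∑ k, gk N k = 0 := by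
  simp_rw [gk_eq]
  rw [← Finset.mul_sum, Fin.sum_univ_eq_sum_range (fun k => Complex.exp (2 * Real.pi * Complex.I / N) ^ k) N,
    (Complex.isPrimitiveRoot_exp N (by omega)).geom_sum_eq_zero (by omega), mul_zero]

lemma sum_gk_sq (N : ℕ) (hN : 3 ≤ N) : ∑ k, gk N k ^ 2 = 0 := by
  simp_rw [gk_eq, mul_pow, ← pow_mul, mul_comm _ 2, pow_mul]
  set w := Complex.exp (2 * Real.pi * Complex.I / N) with hw
  have hp := Complex.isPrimitiveRoot_exp N (by omega)
  rw [← Finset.mul_sum, Fin.sum_univ_eq_sum_range (fun k => (w ^ 2) ^ k) N]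
  have h1 : w ^ 2 ≠ 1 := hp.pow_ne_one_of_pos_of_lt (by norm_num) (by omega)
  have h2 := geom_sum_mul (w ^ 2) N
  rw [← pow_mul, mul_comm 2 N, pow_mul, hp.pow_eq_one, one_pow, sub_self] at h2
  rcases mul_eq_zero.1 h2 with h | h
  · rw [h, mul_zero]
  · exact absurd (sub_eq_zero.1 h) h1

lemma gk_mul_conj (N : ℕ) (k : Fin N) : gk N k * (starRingEnd ℂ) (gk N k) = 1 := by
  rw [Complex.mul_conj, gk, Complex.normSq_eq_norm_sq, Complex.norm_exp_ofReal_mul_I]; simp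

lemma sum_re_gk (N : ℕ) (hN : 3 ≤ N) (z : ℂ) :
    ∑ k, (((2 / N * (z * (starRingEnd ℂ) (gk N k)).re : ℝ)) : ℂ) * gk N k = z := by
  have hN0 : (N : ℂ) ≠ 0 := by exact_mod_cast (by omega : N ≠ 0)
  have : ∀ k, (((2 / N * (z * (starRingEnd ℂ) (gk N k)).re : ℝ)) : ℂ) * gk N k =
      1 / N * z + 1 / N * (starRingEnd ℂ) z * gk N k ^ 2 := by
    intro k
    have h := Complex.add_conj (z * (starRingEnd ℂ) (gk N k))
    have h' := gk_mul_conj N k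
    rw [map_mul, Complex.conj_conj] at h
    push_cast at h ⊢
    have : ((z * (starRingEnd ℂ) (gk N k)).re : ℂ) =
      (z * (starRingEnd ℂ) (gk N k) + (starRingEnd ℂ) z * gk N k) / 2 := by rw [h]; ring
    rw [this]
    field_simp
    linear_combination z * h'
  rw [Finset.sum_congr rfl fun k _ => this k, Finset.sum_add_distrib, ← Finset.mul_sum,
    ← Finset.mul_sum, sum_gk_sq N hN]
  simp
  field_simp

lemma sum_re_gk' (N : ℕ) (hN : 3 ≤ N) (z : ℂ) :
    ∑ k, (z * (starRingEnd ℂ) (gk N k)).re = 0 := by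
  rw [← Complex.re_sum, ← Finset.mul_sum, ← map_sum, sum_gk N hN]; simp

noncomputable def rho (N : ℕ) (j : Fin N) (φ : ℝ) : ℝ :=
  max 0 (min 1 ((φ + Real.pi) * N / (2 * Real.pi) - j))

lemma rho_cont (N : ℕ) (j : Fin N) : Continuous (rho N j) := by
  unfold rho; fun_prop

lemma rho_pi (N : ℕ) (j : Fin N) : rho N j Real.pi = 1 := by
  have h : (Real.pi + Real.pi) * N / (2 * Real.pi) = N := by field_simp; ring
  rw [rho, h]
  have : ((j : ℕ) : ℝ) + 1 ≤ N := by exact_mod_cast j.2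
  rw [min_eq_left (by linarith)]; simp

lemma rho_neg_pi (N : ℕ) (j : Fin N) : rho N j (-Real.pi) = 0 := by
  rw [rho]
  have : (0:ℝ) ≤ (j : ℕ) := by positivity
  rw [neg_add_cancel, zero_mul, zero_div, max_eq_left]
  exact (min_le_right _ _).trans (by linarith)

lemma re_mul_conj_gk (N : ℕ) (k : Fin N) (z : ℂ) : (z * (starRingEnd ℂ) (gk N k)).re =
    - (‖z‖ * Real.cos (z.arg + Real.pi - (2 * (k : ℝ) + 1) * (Real.pi / N))) := by
  have : z * (starRingEnd ℂ) (gk N k) =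
    ‖z‖ * Complex.exp (((z.arg - (2 * (k : ℝ) + 1) * (Real.pi / N) : ℝ)) * Complex.I) := by
    conv_lhs => rw [← Complex.norm_mul_exp_arg_mul_I z]
    rw [gk, ← Complex.exp_conj, mul_assoc, ← Complex.exp_add]
    congr 2
    rw [map_mul, Complex.conj_I, Complex.conj_ofReal]
    push_cast
    ring
  rw [this, Complex.re_ofReal_mul, Complex.exp_ofReal_mul_I_re,
    show z.arg + Real.pi - (2 * (k : ℝ) + 1) * (Real.pi / N) =
      z.arg - (2 * (k : ℝ) + 1) * (Real.pi / N) + Real.pi by ring, Real.cos_add_pi]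
  ring

lemma abs_le_of_cos {x η : ℝ} (h0 : 0 ≤ η) (hx : |x| < 2 * Real.pi - η)
    (h : Real.cos η ≤ Real.cos x) : |x| ≤ η := by
  by_contra! hc
  rw [← Real.cos_abs x] at h
  rcases le_or_gt |x| Real.pi with h1 | h1
  · exact absurd h (not_le.2 (Real.cos_lt_cos_of_nonneg_of_le_pi h0 h1 hc))
  · have := Real.cos_lt_cos_of_nonneg_of_le_pi h0 (y := 2 * Real.pi - |x|) (by linarith) (by linarith)
    rw [Real.cos_two_pi_sub] at this
    linarith

lemma rho_of_zero (N : ℕ) (hN : 3 ≤ N) (z : ℂ) 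
    (h : ∀ k : Fin N, 0 ≤ (1:ℝ) / N + 2 / N * (z * (starRingEnd ℂ) (gk N k)).re) (j : Fin N)
    (hj : (1:ℝ) / N + 2 / N * (z * (starRingEnd ℂ) (gk N j)).re = 0) (k : Fin N) (hk : k ≠ j) :
    rho N k z.arg = 0 ∨ rho N k z.arg = 1 := by
  have hN0 : (0:ℝ) < N := by exact_mod_cast (by omega : 0 < N)
  have hπ := Real.pi_pos
  have hz : 0 < ‖z‖ := by
    rw [norm_pos_iff]; rintro rfl
    simp at hj; omega
  have hcos : ∀ k : Fin N, Real.cos (z.arg + Real.pi - (2 * (k : ℝ) + 1) * (Real.pi / N)) ≤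
      Real.cos (z.arg + Real.pi - (2 * (j : ℝ) + 1) * (Real.pi / N)) := by
    intro k
    have h1 := h k
    rw [← hj, re_mul_conj_gk, re_mul_conj_gk] at h1
    have h2 : (0:ℝ) < 2 / N := by positivity
    have h3 := le_of_mul_le_mul_left (le_of_add_le_add_left h1) h2
    exact le_of_mul_le_mul_left (neg_le_neg_iff.1 h3) hz
  rcases eq_or_lt_of_le (Complex.arg_le_pi z) with hφ | hφ
  · right; rw [hφ, rho_pi]
  set t := (z.arg + Real.pi) * N / (2 * Real.pi) with ht
  have harg := Complex.neg_pi_lt_arg z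
  have ht0 : 0 < t := by rw [ht]; have : 0 < z.arg + Real.pi := by linarith
                         positivity
  have htN : t < N := by
    rw [ht, div_lt_iff₀ (by positivity)]; nlinarith
  have hθ : z.arg + Real.pi = t * (2 * (Real.pi / N)) := by rw [ht]; field_simp
  set η := Real.pi / N with hη
  have hη0 : 0 < η := by positivity
  have hηN : η * N = Real.pi := by rw [hη]; field_simp
  have hk0 : ⌊t⌋₊ < N := (Nat.floor_lt ht0.le).2 htN
  have hf1 := Nat.floor_le ht0.le
  have hf2 := Nat.lt_floor_add_one t
  have h1 := hcos ⟨_, hk0⟩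
  rw [hθ] at h1
  have hηπ : η ≤ Real.pi := by
    rw [← hηN]
    have : (3:ℝ) ≤ N := by exact_mod_cast hN
    nlinarith
  have h2 : Real.cos η ≤ Real.cos (t * (2 * η) - (2 * ((⟨⌊t⌋₊, hk0⟩ : Fin N) : ℝ) + 1) * η) := by
    rw [← Real.cos_abs (_ - _)]
    refine Real.cos_le_cos_of_nonneg_of_le_pi (abs_nonneg _) hηπ ?_
    simp only
    rw [abs_le]; constructor <;> nlinarith
  have hjN : ((j : ℕ) : ℝ) + 1 ≤ N := by exact_mod_cast j.2
  have hj0 : (0 : ℝ) ≤ ((j : ℕ) : ℝ) := by positivity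
  have h3 := abs_le_of_cos hη0.le (by
    rw [abs_lt]; constructor <;> nlinarith) (h2.trans h1)
  rw [abs_le] at h3
  have h4 : (j : ℝ) ≤ t := by
    by_contra! hc
    nlinarith
  have h5 : t ≤ j + 1 := by
    by_contra! hc
    nlinarith
  rw [rho, ← ht]
  rcases lt_or_gt_of_ne hk with hlt | hgt
  · right
    have : ((k : ℕ) : ℝ) + 1 ≤ (j : ℕ) := by exact_mod_cast hlt
    rw [min_eq_left (by linarith)]; simp
  · left
    have : ((j : ℕ) : ℝ) + 1 ≤ (k : ℕ) := by exact_mod_cast hgt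
    rw [max_eq_left]
    exact (min_le_right _ _).trans (by linarith)

noncomputable def Wc (N : ℕ) (c : Fin N → ℤ) (φ : ℝ) : ℝ := ∑ j, (c j : ℝ) * rho N j φ

lemma Wc_cont (N : ℕ) (c : Fin N → ℤ) : Continuous (Wc N c) := by
  unfold Wc
  exact continuous_finsetSum _ fun j _ => continuous_const.mul (rho_cont N j)

lemma Wc_pi (N : ℕ) (c : Fin N → ℤ) : Wc N c Real.pi = (∑ j, c j : ℤ) := by
  simp [Wc, rho_pi]

lemma Wc_neg_pi (N : ℕ) (c : Fin N → ℤ) : Wc N c (-Real.pi) = 0 := by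
  simp [Wc, rho_neg_pi]

noncomputable def Fz (N : ℕ) (c : Fin N → ℤ) (z : ℂ) (m : ℝ) : ℂ :=
  -((‖z‖ + m : ℝ) : ℂ) *
    Complex.exp ((((1 - N * m) * (z.arg + Real.pi - 2 * Real.pi * Wc N c z.arg) : ℝ) : ℂ) * Complex.I)

lemma Fz_zero (N : ℕ) (c : Fin N → ℤ) (z : ℂ) : Fz N c z 0 =
    z * Complex.exp ((-(2 * Real.pi * Wc N c z.arg) : ℝ) * Complex.I) := by
  rw [Fz]
  have hz := Complex.norm_mul_exp_arg_mul_I z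
  have : ((((1 - N * 0) * (z.arg + Real.pi - 2 * Real.pi * Wc N c z.arg) : ℝ) : ℂ) * Complex.I) =
    z.arg * Complex.I + (-(2 * Real.pi * Wc N c z.arg) : ℝ) * Complex.I + Real.pi * Complex.I := by
    push_cast; ring
  rw [this, Complex.exp_add, Complex.exp_add, Complex.exp_pi_mul_I, add_zero]
  linear_combination Complex.exp ((-(2 * Real.pi * Wc N c z.arg) : ℝ) * Complex.I) * hz

lemma Fz_ne_zero (N : ℕ) (c : Fin N → ℤ) (z : ℂ) (m : ℝ) (h : 0 < ‖z‖ + m) : Fz N c z m ≠ 0 := by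
  rw [Fz]
  refine mul_ne_zero (neg_ne_zero.2 ?_) (Complex.exp_ne_zero _)
  exact_mod_cast h.ne'

lemma exp_int_mul (a : ℤ) (x : ℝ) :
    Complex.exp ((-(2 * Real.pi * (x + a)) : ℝ) * Complex.I) =
      Complex.exp ((-(2 * Real.pi * x) : ℝ) * Complex.I) := by
  rw [Complex.exp_eq_exp_iff_exists_int]
  refine ⟨-a, ?_⟩
  push_cast; ring

lemma Fz_zero_eq (N : ℕ) (c : Fin N → ℤ) (z : ℂ) (j : Fin N)
    (h : ∀ k, k ≠ j → rho N k z.arg = 0 ∨ rho N k z.arg = 1) : Fz N c z 0 =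
    z * Complex.exp ((-(2 * Real.pi * ((c j : ℝ) * rho N j z.arg)) : ℝ) * Complex.I) := by
  rw [Fz_zero]
  have : ∃ a : ℤ, Wc N c z.arg = (c j : ℝ) * rho N j z.arg + a := by
    refine ⟨∑ k ∈ Finset.univ.erase j, if rho N k z.arg = 1 then c k else 0, ?_⟩
    rw [Wc, ← Finset.add_sum_erase _ _ (Finset.mem_univ j)]
    congr 1
    push_cast
    refine Finset.sum_congr rfl fun k hk => ?_
    rcases h k (Finset.ne_of_mem_erase hk) with h | h <;> simp [h]
  obtain ⟨a, ha⟩ := this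
  rw [ha, exp_int_mul]

lemma cont_arg {E : Type*} [TopologicalSpace E] (f : ℝ → E) (hf : Continuous f)
    (h : f (-Real.pi) = f Real.pi) (z : ℂ) (hz : z ≠ 0) : ContinuousAt (fun z : ℂ => f z.arg) z := by
  haveI : Fact (0 < 2 * Real.pi) := ⟨by have := Real.pi_pos; positivity⟩
  have hp : -Real.pi + 2 * Real.pi = Real.pi := by ring
  have h1 : Continuous (AddCircle.liftIoc (2 * Real.pi) (-Real.pi) f) :=
    AddCircle.liftIoc_continuous (by rw [hp]; exact h) hf.continuousOn
  have h2 : (fun z : ℂ => f z.arg) =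
      fun z : ℂ => AddCircle.liftIoc (2 * Real.pi) (-Real.pi) f ((z.arg : Real.Angle) : AddCircle (2 * Real.pi)) := by
    funext z
    refine (AddCircle.liftIoc_coe_apply ?_).symm
    rw [hp]; exact ⟨Complex.neg_pi_lt_arg z, Complex.arg_le_pi z⟩
  rw [h2]
  exact ContinuousAt.comp (f := fun z : ℂ => ((z.arg : Real.Angle))) h1.continuousAt
    (Complex.continuousAt_arg_coe_angle hz)

lemma Fz_zero_cont (N : ℕ) (c : Fin N → ℤ) : Continuous fun z => Fz N c z 0 := by
  simp_rw [Fz_zero]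
  rw [continuous_iff_continuousAt]
  intro z
  by_cases hz : z = 0
  · subst hz
    rw [ContinuousAt, zero_mul, tendsto_zero_iff_norm_tendsto_zero]
    simp_rw [norm_mul, Complex.norm_exp_ofReal_mul_I, mul_one]
    exact tendsto_norm_zero
  · refine continuousAt_id.mul (cont_arg (fun φ => Complex.exp ((-(2 * Real.pi * Wc N c φ) : ℝ) * Complex.I)) ?_ ?_ z hz)
    · have := Wc_cont N c
      fun_prop
    · rw [Wc_pi, Wc_neg_pi, ← zero_add (((∑ j, c j : ℤ)) : ℝ), exp_int_mul]

lemma Fz_cont (N : ℕ) (hN : 3 ≤ N) (c : Fin N → ℤ) (hc : ∑ j, c j = 1) (z : ℂ) (m : ℝ)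
    (h : z ≠ 0 ∨ m = 1 / N) : ContinuousAt (fun p : ℂ × ℝ => Fz N c p.1 p.2) (z, m) := by
  have hN0 : (N:ℝ) ≠ 0 := by exact_mod_cast (by omega : N ≠ 0)
  have hW := Wc_cont N c
  unfold Fz
  have key : ContinuousAt (fun p : ℂ × ℝ => (1 - N * p.2) * (p.1.arg + Real.pi - 2 * Real.pi * Wc N c p.1.arg)) (z, m) := by
    by_cases hz : z = 0
    · have hm : m = 1 / N := h.resolve_left (not_not.2 hz)
      have hm' : 1 - N * m = 0 := by rw [hm]; field_simp; simp
      obtain ⟨B, hB⟩ := (isCompact_Icc (a := -Real.pi) (b := Real.pi)).exists_bound_of_continuousOn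
        (f := fun φ => φ + Real.pi - 2 * Real.pi * Wc N c φ) (by fun_prop)
      rw [ContinuousAt]
      simp only [hm', zero_mul]
      refine Filter.Tendsto.zero_mul_isBoundedUnder_le ?_ ?_
      · have : Continuous fun p : ℂ × ℝ => 1 - N * p.2 := by fun_prop
        have := this.tendsto (z, m)
        simpa only [hm'] using this
      · exact Filter.isBoundedUnder_of ⟨B, fun p => hB _ ⟨(Complex.neg_pi_lt_arg _).le, Complex.arg_le_pi _⟩⟩
    · refine ContinuousAt.mul (by fun_prop) ?_
      have := cont_arg (fun φ => φ + Real.pi - 2 * Real.pi * Wc N c φ) (by fun_prop)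
        (by rw [Wc_pi, Wc_neg_pi, hc]; push_cast; ring) z hz
      exact ContinuousAt.comp (f := fun p : ℂ × ℝ => p.1) (x := (z, m)) this continuousAt_fst
  have key2 := (Complex.continuous_ofReal.continuousAt.comp key)
  have h3 : Continuous fun p : ℂ × ℝ => -((‖p.1‖ + p.2 : ℝ) : ℂ) := by fun_prop
  exact h3.continuousAt.mul (Complex.continuous_exp.continuousAt.comp (key2.mul continuousAt_const))
end

section
lemma shrink_ge_two {Y : Type*} [MetricSpace Y] {ι : Type*} {N : ℕ} [NeZero N] (hN : 3 ≤ N)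
    (col : ι → Fin N)
    (coarse : Fin N → ι) (V : ι → Set Y) (C : Fin N → (Fin N → ι) → ℤ)
    (h1 : ∀ k, col (coarse k) = k) (h2 : ∀ v, IsOpen (V v)) (h3 : ∀ y, ∃ v, y ∈ V v)
    (h4 : ∀ v w, col v = col w → v ≠ w → Disjoint (V v) (V w))
    (h5 : ∀ j s s', (∀ k, k ≠ j → s k = s' k) → C j s = C j s')
    (h6 : ∀ j s, (∀ k, k ≠ j → s k = coarse k) → C j s = 0)
    (h7 : ∀ s, (∀ k, col (s k) = k) → (∃ y, ∀ k, y ∈ V (s k)) → ∑ j, C j s = 1) :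
    ∃ P : Fin N → Set Y, (∀ i, IsOpen (P i)) ∧ (∀ y, ∃ i, y ∈ P i) ∧ (∀ y, ∃ i, y ∉ P i) ∧
      ∀ k, ∀ y ∈ P k, y ∈ V (coarse k) ∨ ∃ v, v ∉ range coarse ∧ y ∈ V v := by
  classical
  obtain ⟨lv, lam, hlc, hl0, hlV, hlf, hLc, hL0, hLs, hLp⟩ := exists_lams col V h2 h3
  have hN0 : (0:ℝ) < N := by exact_mod_cast (by omega : 0 < N)
  have hactV : ∀ v y, 0 < lv v y → y ∈ V v := fun v y h =>
    hlV v (subset_tsupport _ (Function.mem_support.2 h.ne'))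
  have uniq : ∀ u v y, col u = col v → y ∈ V u → y ∈ V v → u = v := by
    intro u v y h hu hv
    by_contra hne
    exact (Set.disjoint_left.1 (h4 u v h hne)) hu hv
  have zero_or : ∀ v y, lv v y = 0 ∨ 0 < lv v y := fun v y =>
    (hl0 v y).eq_or_lt.imp Eq.symm id
  have Lzero_or : ∀ k y, lam k y = 0 ∨ 0 < lam k y := fun v y =>
    (hL0 v y).eq_or_lt.imp Eq.symm id
  -- base functions
  set z : Y → ℂ := fun y => ∑ k, (lam k y : ℂ) * gk N k with hz
  have hzc : Continuous z := by
    refine continuous_finsetSum _ fun k _ => ?_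
    have := hLc k
    fun_prop
  set m : Y → ℝ := fun y => Finset.univ.inf' ⟨(0 : Fin N), Finset.mem_univ _⟩ (fun k => lam k y) with hm
  have hmc : Continuous m := Continuous.finset_inf'_apply _ fun k _ => hLc k
  have hmle : ∀ y k, m y ≤ lam k y := fun y k => Finset.inf'_le _ (Finset.mem_univ k)
  have hmex : ∀ y, ∃ k, m y = lam k y := by
    intro y
    obtain ⟨k, -, hk⟩ := Finset.exists_mem_eq_inf' ⟨(0 : Fin N), Finset.mem_univ _⟩ (fun k => lam k y)
    exact ⟨k, hk⟩
  have hm0 : ∀ y, 0 ≤ m y := by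
    intro y; obtain ⟨k, hk⟩ := hmex y; rw [hk]; exact hL0 k y
  set Z : Set Y := {y | ∀ k, lam k y = 1 / N + 2 / N * (z y * (starRingEnd ℂ) (gk N k)).re} with hZ
  have hZcl : IsClosed Z := by
    rw [hZ, Set.ofPred_forall]
    refine isClosed_iInter fun k => isClosed_eq (hLc k) ?_
    have : Continuous fun y => (z y * (starRingEnd ℂ) (gk N k)).re :=
      Complex.continuous_re.comp (hzc.mul continuous_const)
    fun_prop
  set A : Set Y := {y | ∀ v, v ∉ range coarse → lv v y = 0} with hA
  have hAcl : IsClosed A := by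
    have : A = ⋂ v, ⋂ _ : v ∉ range coarse, {y | lv v y = 0} := by
      ext y; simp [hA]
    rw [this]
    exact isClosed_iInter fun v => isClosed_iInter fun _ => isClosed_eq (hlc v) continuous_const
  have hrho : ∀ y ∈ Z, ∀ j, lam j y = 0 → ∀ k, k ≠ j → rho N k (z y).arg = 0 ∨ rho N k (z y).arg = 1 := by
    intro y hy j hj k hk
    refine rho_of_zero N hN (z y) (fun k => ?_) j ?_ k hk
    · rw [← hy k]; exact hL0 k y
    · rw [← hy j]; exact hj
  have hzm : ∀ y ∈ Z, z y ≠ 0 ∨ m y = 1 / N := by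
    intro y hy
    by_cases h : z y = 0
    · right
      obtain ⟨k, hk⟩ := hmex y
      rw [hk, hy k, h]; simp
    · exact Or.inl h
  -- compatible selections
  let compat : (Fin N → ι) → Y → Prop := fun s y => ∀ v, 0 < lv v y → s (col v) = v
  have hindep : ∀ y ∈ Z, ∀ s s', compat s y → compat s' y →
      Fz N (fun j => C j s) (z y) (m y) = Fz N (fun j => C j s') (z y) (m y) := by
    intro y hy s s' hs hs'
    have hag : ∀ k, 0 < lam k y → s k = s' k := by
      intro k hk
      obtain ⟨v, rfl, hv⟩ := (hLp k y).1 hk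
      rw [hs v hv, hs' v hv]
    obtain ⟨j, hj⟩ := hmex y
    rcases Lzero_or j y with h0 | hpos
    · rw [hj, h0, Fz_zero_eq N _ _ j (hrho y hy j h0), Fz_zero_eq N _ _ j (hrho y hy j h0)]
      by_cases hj' : ∃ j', j' ≠ j ∧ lam j' y = 0
      · obtain ⟨j', hne, hj'⟩ := hj'
        have : ∀ a : ℤ, Complex.exp ((-(2 * Real.pi * ((a : ℝ) * rho N j (z y).arg)) : ℝ) * Complex.I) = 1 := by
          intro a
          rcases hrho y hy j' hj' j hne.symm with h | h
          · rw [h]; simp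
          · rw [h, mul_one]
            have := exp_int_mul a 0
            rw [zero_add] at this
            rw [this]; simp
        rw [this, this]
      · push Not at hj'
        have : C j s = C j s' := h5 j s s' fun k hk => hag k ((Lzero_or k y).resolve_left (hj' k hk))
        rw [this]
    · have : s = s' := by
        funext k
        exact hag k (hpos.trans_le (hj ▸ hmle y k))
      rw [this]
  have hsel : ∀ y, ∃ s : Fin N → ι, compat s y ∧ ∀ k, col (s k) = k ∧ (s k = coarse k ∨ 0 < lv (s k) y) := by
    intro y
    refine ⟨fun k => if h : ∃ v, col v = k ∧ 0 < lv v y then h.choose else coarse k, ?_, ?_⟩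
    · intro v hv
      have h : ∃ w, col w = col v ∧ 0 < lv w y := ⟨v, rfl, hv⟩
      simp only [dif_pos h]
      exact uniq _ _ y h.choose_spec.1 (hactV _ _ h.choose_spec.2) (hactV _ _ hv)
    · intro k
      by_cases h : ∃ v, col v = k ∧ 0 < lv v y
      · simp only [dif_pos h]
        exact ⟨h.choose_spec.1, Or.inr h.choose_spec.2⟩
      · simp only [dif_neg h]
        exact ⟨h1 k, by simp⟩
  choose sel hsel1 hsel2 using hsel
  set ζ : Y → ℂ := fun y => Fz N (fun j => C j (sel y)) (z y) (m y) with hζ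
  have hζne : ∀ y ∈ Z, ζ y ≠ 0 := by
    intro y hy
    refine Fz_ne_zero _ _ _ _ ?_
    rcases hzm y hy with h | h
    · have := norm_pos_iff.2 h
      have := hm0 y
      linarith
    · have : 0 < m y := by rw [h]; positivity
      positivity
  have hζA : ∀ y ∈ Z, y ∈ A → ζ y = z y := by
    intro y hy hyA
    have hc : compat coarse y := by
      intro v hv
      by_cases hr : v ∈ range coarse
      · obtain ⟨k, rfl⟩ := hr
        rw [h1]
      · exact absurd (hyA v hr) hv.ne'
    have hC0 : ∀ j, C j coarse = 0 := fun j => h6 j coarse fun _ _ => rfl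
    have hmy : m y = 0 := by
      by_contra hne
      have hpos := lt_of_le_of_ne (hm0 y) (Ne.symm hne)
      have := h7 coarse h1 ⟨y, fun k => by
        obtain ⟨v, hv, hv'⟩ := (hLp k y).1 (hpos.trans_le (hmle y k))
        have := hc v hv'
        rw [hv] at this
        rw [this]; exact hactV v y hv'⟩
      simp [hC0] at this
    rw [hζ]
    simp only
    rw [hindep y hy _ _ (hsel1 y) hc, hmy, Fz_zero]
    simp [Wc, hC0]
  -- continuity on Z
  let D : (Fin N → ι) → Set Y := fun s => {y | y ∈ Z ∧ (∀ k, col (s k) = k) ∧ compat s y ∧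
    ∀ k, s k = coarse k ∨ y ∈ tsupport (lv (s k))}
  have hDcl : ∀ s, IsClosed (D s) := by
    intro s
    have : D s = Z ∩ ({y | ∀ k, col (s k) = k} ∩ ((⋂ v, ⋂ _ : s (col v) ≠ v, {y | lv v y = 0}) ∩
        ⋂ k, ({y | s k = coarse k} ∪ tsupport (lv (s k))))) := by
      ext y
      simp only [D, compat, mem_inter_iff, mem_iInter, mem_union, Set.mem_ofPred_eq]
      refine and_congr_right fun _ => and_congr_right fun _ => and_congr_left fun _ => ?_
      refine forall_congr' fun v => ?_
      constructor
      · intro h hne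
        exact (zero_or v y).resolve_right fun hp => hne (h hp)
      · intro h hp
        by_contra hne
        exact hp.ne' (h hne)
    rw [this]
    refine hZcl.inter (isClosed_const.inter (IsClosed.inter ?_ ?_))
    · exact isClosed_iInter fun v => isClosed_iInter fun _ => isClosed_eq (hlc v) continuous_const
    · exact isClosed_iInter fun k => isClosed_const.union (isClosed_tsupport _)
  have hDlf : LocallyFinite D := by
    intro y
    obtain ⟨t, ht, hfin⟩ := hlf y
    refine ⟨t, ht, ?_⟩
    have hfin2 : (({v | (tsupport (lv v) ∩ t).Nonempty} ∪ range coarse)).Finite :=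
      hfin.union (finite_range _)
    refine (Set.Finite.pi' (fun _ : Fin N => hfin2)).subset ?_
    rintro s ⟨x, hx, hxt⟩ k
    rcases hx.2.2.2 k with h | h
    · right; exact ⟨k, h.symm⟩
    · left; exact ⟨x, h, hxt⟩
  have hDun : Z = ⋃ s, D s := by
    ext y
    simp only [mem_iUnion]
    constructor
    · intro hy
      refine ⟨sel y, hy, fun k => (hsel2 y k).1, hsel1 y, fun k => (hsel2 y k).2.imp id fun h => ?_⟩
      exact subset_tsupport _ (Function.mem_support.2 h.ne')
    · rintro ⟨s, hs⟩
      exact hs.1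
  have hζc : ContinuousOn ζ Z := by
    rw [hDun]
    refine hDlf.continuousOn_iUnion hDcl fun s => ?_
    have hcg : ∀ y ∈ D s, ζ y = Fz N (fun j => C j s) (z y) (m y) := fun y hy =>
      hindep y hy.1 _ _ (hsel1 y) hy.2.2.1
    by_cases hex : ∃ y ∈ D s, 0 < m y
    · obtain ⟨y0, hy0, hmy0⟩ := hex
      have hsum : ∑ j, C j s = 1 := h7 s hy0.2.1 ⟨y0, fun k => by
        obtain ⟨v, hv, hv'⟩ := (hLp k y0).1 (hmy0.trans_le (hmle y0 k))
        have := hy0.2.2.1 v hv'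
        rw [hv] at this
        rw [this]; exact hactV v y0 hv'⟩
      refine ContinuousOn.congr (f := fun y => Fz N (fun j => C j s) (z y) (m y)) ?_ hcg
      intro y hy
      have h := Fz_cont N hN (fun j => C j s) hsum (z y) (m y) (hzm y hy.1)
      exact (ContinuousAt.comp (f := fun y => (z y, m y)) (x := y) h
        (hzc.prodMk hmc).continuousAt).continuousWithinAt
    · push Not at hex
      refine ContinuousOn.congr (f := fun y => Fz N (fun j => C j s) (z y) 0) ?_ ?_
      · exact ((Fz_zero_cont N (fun j => C j s)).comp hzc).continuousOn
      · intro y hy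
        rw [hcg y hy, le_antisymm (hex y hy) (hm0 y)]
  -- extend
  set ζ0 : Y → ℂ := fun y => if y ∈ A then z y else ζ y with hζ0
  have hζ0Z : ∀ y ∈ Z, ζ0 y = ζ y := by
    intro y hy
    by_cases hyA : y ∈ A
    · simp only [hζ0, if_pos hyA]; exact (hζA y hy hyA).symm
    · simp only [hζ0, if_neg hyA]
  have hζ0A : ∀ y ∈ A, ζ0 y = z y := fun y hy => by simp only [hζ0, if_pos hy]
  have hcont : ContinuousOn ζ0 (A ∪ Z) :=
    (hzc.continuousOn.congr hζ0A).union_of_isClosed (hζc.congr hζ0Z) hAcl hZcl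
  obtain ⟨E, hE⟩ := ContinuousMap.exists_restrict_eq (hAcl.union hZcl)
    (⟨(A ∪ Z).restrict ζ0, hcont.restrict⟩ : C((A ∪ Z : Set Y), ℂ))
  have hEe : ∀ y ∈ A ∪ Z, E y = ζ0 y := by
    intro y hy
    have := congrArg (fun f : C((A ∪ Z : Set Y), ℂ) => f ⟨y, hy⟩) hE
    exact this
  set q : Fin N → Y → ℝ := fun k y => lam k y + 2 / N * ((E y - z y) * (starRingEnd ℂ) (gk N k)).re with hq
  have hqc : ∀ k, Continuous (q k) := by
    intro k
    have : Continuous fun y => ((E y - z y) * (starRingEnd ℂ) (gk N k)).re :=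
      Complex.continuous_re.comp ((E.continuous.sub hzc).mul continuous_const)
    exact (hLc k).add (continuous_const.mul this)
  have hqnc : ∀ y, ∃ i j, q i y ≠ q j y := by
    intro y
    by_contra! hcon
    have hc : ∀ k, q k y = q 0 y := fun k => hcon k 0
    have hs1 : ∑ k, (q k y : ℂ) * gk N k = E y := by
      have : ∀ k, (q k y : ℂ) * gk N k = (lam k y : ℂ) * gk N k +
        ((2 / N * ((E y - z y) * (starRingEnd ℂ) (gk N k)).re : ℝ) : ℂ) * gk N k := by
        intro k; rw [hq]; push_cast; ring
      rw [Finset.sum_congr rfl fun k _ => this k, Finset.sum_add_distrib, sum_re_gk N hN]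
      simp only [hz]; ring
    have hE0 : E y = 0 := by
      rw [← hs1, Finset.sum_congr rfl fun k _ => by rw [hc k], ← Finset.mul_sum, sum_gk N hN, mul_zero]
    have hs2 : ∑ k, q k y = 1 := by
      simp only [hq]
      rw [Finset.sum_add_distrib, ← Finset.mul_sum, sum_re_gk' N hN, hLs]; simp
    have hc0 : q 0 y = 1 / N := by
      rw [Finset.sum_congr rfl fun k _ => hc k] at hs2
      simp only [Finset.sum_const, Finset.card_univ, Fintype.card_fin, nsmul_eq_mul] at hs2
      rw [eq_div_iff hN0.ne', mul_comm]; exact hs2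
    have hyZ : y ∈ Z := by
      intro k
      have h := hc k
      rw [hc0] at h
      simp only [hq] at h
      rw [hE0, zero_sub, neg_mul, Complex.neg_re] at h
      linarith
    apply hζne y hyZ
    rw [← hζ0Z y hyZ, ← hEe y (Or.inr hyZ), hE0]
  refine ⟨fun i => {y | ∃ k, q k y < q i y}, ?_, ?_, ?_, ?_⟩
  · intro i
    change IsOpen {y | ∃ k, q k y < q i y}
    rw [Set.ofPred_exists]
    exact isOpen_iUnion fun k => isOpen_lt (hqc k) (hqc i)
  · intro y
    obtain ⟨i, j, hij⟩ := hqnc y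
    rcases lt_or_gt_of_ne hij with h | h
    · exact ⟨j, i, h⟩
    · exact ⟨i, j, h⟩
  · intro y
    obtain ⟨i, hi⟩ := Finite.exists_min (fun k => q k y)
    refine ⟨i, ?_⟩
    rintro ⟨k, hk⟩
    exact absurd (hi k) (not_le.2 hk)
  · rintro i y ⟨k, hk⟩
    by_cases hyA : y ∈ A
    · left
      have hql : ∀ k, q k y = lam k y := by
        intro k
        simp only [hq]
        rw [hEe y (Or.inl hyA), hζ0A y hyA]; simp
      rw [hql, hql] at hk
      obtain ⟨v, hv, hv'⟩ := (hLp i y).1 ((hL0 k y).trans_lt hk)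
      have hr : v ∈ range coarse := by
        by_contra hr
        exact hv'.ne' (hyA v hr)
      obtain ⟨k', rfl⟩ := hr
      rw [h1] at hv
      rw [← hv]; exact hactV _ _ hv'
    · right
      simp only [hA, Set.mem_ofPred_eq, not_forall] at hyA
      obtain ⟨v, hv, hne⟩ := hyA
      exact ⟨v, hv, hactV v y ((zero_or v y).resolve_left hne)⟩

lemma dim_drop {Y : Type*} [MetricSpace Y] {m : ℕ} (h : DimLE (Y × ℝ) (m + 1)) : DimLE Y m := by
  have hY : DimLE Y (m + 1) := dimLE_of_slice h
  refine dimLE_of_shrink hY fun U hU hUc => ?_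
  obtain ⟨ι, col, coarse, V, C, g1, g2, g3, g4, g5, g6, g7, g8, g9⟩ := setup_data hY h U hU hUc
  have key : ∃ P : Fin (m + 1 + 1) → Set Y, (∀ i, IsOpen (P i)) ∧ (∀ y, ∃ i, y ∈ P i) ∧
      (∀ y, ∃ i, y ∉ P i) ∧
      ∀ k, ∀ y ∈ P k, y ∈ V (coarse k) ∨ ∃ v, v ∉ range coarse ∧ y ∈ V v := by
    rcases m with _ | m
    · exact shrink_one col coarse V C g1 g2 g3 g4 g7 g8 g9
    · exact shrink_ge_two (by omega) col coarse V C g1 g2 g3 g4 g7 g8 g9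
  obtain ⟨P, p1, p2, p3, p4⟩ := key
  refine ⟨P, p1, fun k y hy => ?_, p2, p3⟩
  rcases p4 k y hy with h | ⟨v, hv, hvy⟩
  · exact g5 k h
  · exact g6 v hv k hvy
end

lemma le_of_sq_le_sq_aux {a b : ℝ} (h : a ^ 2 ≤ b ^ 2) (hb : 0 ≤ b) : a ≤ b :=
  (le_abs_self a).trans (abs_le_of_sq_le_sq h hb)

/-- Structure of the min set of a hyperbolic isometry `γ` of a CAT(0) space `X`:
`Min(γ)` is isometric to a product `Y × ℝ` (with the Euclidean product metric), where
`Y = Y × {0}` is a closed convex subspace of `X`; moreover, if `X` has finite topological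
dimension, then `dim Y < dim X`. -/
theorem minSet_splits_off_line
    (X : Type*) [MetricSpace X] (hX : IsCAT0 X)
    (γ : X ≃ᵢ X) (hγ : IsHyperbolic γ) :
    ∃ Y : Set X, Y ⊆ minSet γ ∧ IsClosed Y ∧ GeodConvex Y ∧
      ∃ e : Y × ℝ ≃ minSet γ,
        (∀ y : Y, ((e (y, 0) : X)) = (y : X)) ∧
        (∀ p q : Y × ℝ,
          dist (e p : X) (e q : X) ^ 2
            = dist (p.1 : X) (q.1 : X) ^ 2 + (p.2 - q.2) ^ 2) ∧
        (covDim X ≠ ⊤ → covDim Y < covDim X) := by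
  obtain ⟨hcl, Y, hne, hYm, hYc, hconv, e, he0, hed⟩ := split_geom hX γ hγ
  refine ⟨Y, hYm, hYc, hconv, e, he0, hed, fun hfin => ?_⟩
  have hlow : ∀ p q : Y × ℝ, dist p q ≤ dist (e p : X) (e q : X) := by
    intro p q
    have h := hed p q
    rw [Prod.dist_eq, Subtype.dist_eq, Real.dist_eq]
    refine max_le ?_ ?_
    · refine le_of_sq_le_sq_aux ?_ dist_nonneg
      nlinarith [sq_nonneg (p.2 - q.2)]
    · refine le_of_sq_le_sq_aux ?_ dist_nonneg
      rw [sq_abs]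
      nlinarith [sq_nonneg (dist (p.1 : X) (q.1 : X))]
  have hup : ∀ p q : Y × ℝ, dist (e p : X) (e q : X) ≤ 2 * dist p q := by
    intro p q
    have h := hed p q
    have h1 : dist (p.1 : X) (q.1 : X) ≤ dist p q := by
      rw [Prod.dist_eq]; exact le_max_left _ _
    have h2 : |p.2 - q.2| ≤ dist p q := by
      rw [Prod.dist_eq, ← Real.dist_eq]; exact le_max_right _ _
    refine le_of_sq_le_sq_aux ?_ (by positivity)
    rw [h, ← sq_abs (p.2 - q.2)]
    nlinarith [abs_nonneg (p.2 - q.2), dist_nonneg (x := (p.1 : X)) (y := (q.1 : X)),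
      dist_nonneg (x := p) (y := q)]
  have hemb : Topology.IsClosedEmbedding (fun p : Y × ℝ => (e p : X)) := by
    have hl : LipschitzWith 2 (fun p : Y × ℝ => (e p : X)) := LipschitzWith.of_dist_le_mul hup
    have ha : AntilipschitzWith 1 (fun p : Y × ℝ => (e p : X)) :=
      AntilipschitzWith.of_le_mul_dist fun p q => by simpa using hlow p q
    refine ⟨(ha.isUniformEmbedding hl.uniformContinuous).isEmbedding, ?_⟩
    have : range (fun p : Y × ℝ => (e p : X)) = minSet γ := by
      ext x
      constructor
      · rintro ⟨p, rfl⟩; exact (e p).2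
      · intro hx; exact ⟨e.symm ⟨x, hx⟩, by simp⟩
    rw [this]; exact hcl
  set S := {d : ℕ∞ | ∃ n : ℕ, d = (n : ℕ∞) ∧ DimLE X n} with hS
  have hSne : S.Nonempty := by
    by_contra hc
    apply hfin
    rw [covDim, ← hS, Set.not_nonempty_iff_eq_empty.1 hc, sInf_empty]
  obtain ⟨n, hn, hdim⟩ : sInf S ∈ S := csInf_mem hSne
  have hX' : covDim X = n := hn
  have hYR : DimLE (Y × ℝ) n := dimLE_of_closedEmbedding hemb hdim
  have : Nonempty Y := hne.to_subtype
  rcases n with _ | m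
  · exact absurd hYR not_dimLE_zero
  · have hYm := dim_drop hYR
    rw [hX']
    refine lt_of_le_of_lt (sInf_le ⟨m, rfl, hYm⟩ : covDim Y ≤ m) ?_
    exact_mod_cast Nat.lt_succ_self m
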